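/- Let F be a free group of rank k with basis x_1, …, x_k and let u ∈ F. If the double F *_u F is isomorphic to a surface group, then u is a surface word: there exists an automorphism φ of F such that φ(u) = [x_1,x_2][x_3,x_4]⋯[x_{k-1},x_k] (which requires k even) or φ(u) = x_1^2 x_2^2 ⋯ x_k^2. -/

import Mathlib

open scoped commutatorElement

/-- The relator `u(x₁,…,x_k)·u(x̄₁,…,x̄_k)⁻¹` presenting the double `F *_u F`. -/
def doubleRel {k : ℕ} (u : FreeGroup (Fin k)) : FreeGroup (Fin k ⊕ Fin k) :=
  FreeGroup.map Sum.inl u * (FreeGroup.map Sum.inr u)⁻¹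

/-- The double `F *_u F` of the free group `F` of rank `k` along the word `u`. -/
def Double {k : ℕ} (u : FreeGroup (Fin k)) : Type :=
  PresentedGroup ({doubleRel u} : Set (FreeGroup (Fin k ⊕ Fin k)))

noncomputable instance {k : ℕ} (u : FreeGroup (Fin k)) : Group (Double u) := by
  unfold Double; infer_instance

/-- The orientable surface relator `[x₁,y₁]⋯[x_g,y_g]`, where `xᵢ = (i, false)` and
`yᵢ = (i, true)`. -/
def orientableRelator (g : ℕ) : FreeGroup (Fin g × Bool) :=
  (List.ofFn fun i : Fin g => ⁅FreeGroup.of (i, false), FreeGroup.of (i, true)⁆).prod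

/-- The non-orientable surface relator `x₁²x₂²⋯x_g²`. -/
def nonorientableRelator (g : ℕ) : FreeGroup (Fin g) :=
  (List.ofFn fun i : Fin g => FreeGroup.of i ^ 2).prod

/-- A surface group: the fundamental group of a closed surface of negative Euler
characteristic. -/
def IsSurfaceGroup (G : Type*) [Group G] : Prop :=
  (∃ g : ℕ, 2 ≤ g ∧
    Nonempty (G ≃* PresentedGroup ({orientableRelator g} : Set (FreeGroup (Fin g × Bool))))) ∨
  (∃ g : ℕ, 3 ≤ g ∧
    Nonempty (G ≃* PresentedGroup ({nonorientableRelator g} : Set (FreeGroup (Fin g)))))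

/-- The word `[x₁,x₂][x₃,x₄]⋯[x_{k-1},x_k]` in the free group on `x₁,…,x_k`. -/
def orientableWordIn (k : ℕ) : FreeGroup (Fin k) :=
  (List.ofFn fun i : Fin (k / 2) =>
    ⁅FreeGroup.of (⟨2 * i.1, by have := i.2; omega⟩ : Fin k),
      FreeGroup.of (⟨2 * i.1 + 1, by have := i.2; omega⟩ : Fin k)⁆).prod

/-- The word `x₁²x₂²⋯x_k²` in the free group on `x₁,…,x_k`. -/
def nonorientableWordIn (k : ℕ) : FreeGroup (Fin k) :=
  (List.ofFn fun i : Fin k => FreeGroup.of i ^ 2).prod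

namespace SurfaceWord

open FreeGroup (of lift)

section Derivations

/-- The mod 2 group algebra. -/
abbrev GA (G : Type*) [Group G] : Type _ := MonoidAlgebra (ZMod 2) G

/-- A group element viewed in the mod 2 group algebra. -/
noncomputable def el {G : Type*} [Group G] (g : G) : GA G := MonoidAlgebra.of (ZMod 2) G g

/-- The mod 2 augmentation. -/
noncomputable def aug (G : Type*) [Group G] : GA G →+* ZMod 2 :=
  (MonoidAlgebra.lift (ZMod 2) (ZMod 2) G 1).toRingHom

variable {G : Type*} [Group G] {H : Type*} [Group H] {X Y : Type*}

@[simp] theorem aug_el (g : G) : aug G (el g) = 1 := by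
  simp [aug, el]

theorem el_mul (g h : G) : el (g * h) = el g * el h := map_mul _ _ _

@[simp] theorem el_one : el (1 : G) = 1 := map_one _

theorem add_self_GA (a : GA G) : a + a = 0 := by
  have : (2 : ZMod 2) • a = 0 := by
    rw [show (2 : ZMod 2) = 0 from rfl, zero_smul]
  rwa [two_smul] at this

/-- Crossed homomorphisms with values in the mod 2 group algebra. -/
def IsDer (π : H →* G) (δ : H → GA G) : Prop :=
  ∀ g h, δ (g * h) = δ g + el (π g) * δ h

namespace IsDer

variable {π : H →* G} {δ δ' : H → GA G}

theorem one (hδ : IsDer π δ) : δ 1 = 0 := by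
  have := hδ 1 1
  simpa using this

theorem inv (hδ : IsDer π δ) (g : H) : δ g⁻¹ = - (el (π g⁻¹) * δ g) := by
  have := hδ g⁻¹ g
  rw [inv_mul_cancel, hδ.one] at this
  exact eq_neg_of_add_eq_zero_left this.symm

theorem mul_right (hδ : IsDer π δ) (a : GA G) : IsDer π (fun h => δ h * a) := by
  intro g h
  simp only [hδ g h, add_mul, mul_assoc]

theorem add (hδ : IsDer π δ) (hδ' : IsDer π δ') : IsDer π (fun h => δ h + δ' h) := by
  intro g h
  simp only [hδ g h, hδ' g h, mul_add]
  abel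

theorem sub (hδ : IsDer π δ) (hδ' : IsDer π δ') : IsDer π (fun h => δ h - δ' h) := by
  intro g h
  simp only [hδ g h, hδ' g h, mul_sub]
  abel

theorem comp {K : Type*} [Group K] (hδ : IsDer π δ) (α : K →* H) :
    IsDer (π.comp α) (fun k => δ (α k)) := by
  intro g h
  simp [hδ _ _]

theorem inner (π : H →* G) (a : GA G) : IsDer π (fun h => (el (π h) - 1) * a) := by
  intro g h
  simp only [map_mul, el_mul, sub_mul, mul_sub, one_mul, mul_assoc]
  abel

theorem conj_of_ker (hδ : IsDer π δ) (g n : H) (hn : π n = 1) :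
    δ (g * n * g⁻¹) = el (π g) * δ n := by
  rw [hδ, hδ, hδ.inv, map_mul, hn, mul_one, mul_neg, ← mul_assoc, ← el_mul, map_inv,
    mul_inv_cancel, el_one, one_mul]
  abel

theorem normalClosure {R : H} (hR : π R = 1) {n : H} (hn : n ∈ Subgroup.normalClosure {R}) :
    ∃ c : GA G, ∀ δ, IsDer π δ → δ n = c * δ R := by
  have hker : ∀ m ∈ Subgroup.normalClosure {R}, π m = 1 := by
    intro m hm
    have : Subgroup.normalClosure {R} ≤ π.ker :=
      Subgroup.normalClosure_le_normal (by simpa using hR)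
    exact this hm
  induction hn using Subgroup.closure_induction with
  | mem x hx =>
    obtain ⟨a, ha, hc⟩ := Group.mem_conjugatesOfSet_iff.1 hx
    rw [Set.mem_singleton_iff] at ha
    subst ha
    obtain ⟨g, rfl⟩ := isConj_iff.1 hc
    exact ⟨el (π g), fun δ hδ => hδ.conj_of_ker g a hR⟩
  | one => exact ⟨0, fun δ hδ => by simp [hδ.one]⟩
  | mul x y hx hy ihx ihy =>
    obtain ⟨c, hc⟩ := ihx
    obtain ⟨d, hd⟩ := ihy
    refine ⟨c + d, fun δ hδ => ?_⟩
    rw [hδ, hc δ hδ, hd δ hδ, hker x hx, el_one, one_mul, add_mul]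
  | inv x hx ih =>
    obtain ⟨c, hc⟩ := ih
    refine ⟨-c, fun δ hδ => ?_⟩
    rw [hδ.inv, hc δ hδ, map_inv, hker x hx, inv_one, el_one, one_mul, neg_mul]

theorem eq_of_generators {π : FreeGroup X →* G} {δ δ' : FreeGroup X → GA G}
    (hδ : IsDer π δ) (hδ' : IsDer π δ') (h : ∀ x, δ (of x) = δ' (of x)) (w : FreeGroup X) :
    δ w = δ' w := by
  induction w using FreeGroup.induction_on with
  | C1 => rw [hδ.one, hδ'.one]
  | of x => exact h x
  | inv_of x ih => rw [hδ.inv, hδ'.inv, ih]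
  | mul x y hx hy => rw [hδ, hδ', hx, hy]

theorem exists_of_generators (π : FreeGroup X →* G) (m : X → GA G) :
    ∃ δ, IsDer π δ ∧ ∀ x, δ (of x) = m x := by
  let T : X → Equiv.Perm (GA G) := fun x =>
    { toFun := fun a => el (π (of x)) * a + m x
      invFun := fun a => el (π (of x))⁻¹ * (a - m x)
      left_inv := fun a => by simp [← mul_assoc, ← el_mul, el_one]
      right_inv := fun a => by simp [← mul_assoc, ← el_mul, el_one] }
  have key : ∀ w a, lift T w a = el (π w) * a + lift T w 0 := by
    intro w
    induction w using FreeGroup.induction_on with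
    | C1 => simp [el_one]
    | of x => simp [T]
    | inv_of x ih =>
      intro a
      simp [T, Equiv.Perm.inv_def, mul_add, sub_eq_add_neg]
    | mul x y hx hy =>
      intro a
      rw [map_mul, Equiv.Perm.mul_apply, Equiv.Perm.mul_apply, hx, hy, hx (lift T y 0), map_mul,
        el_mul]
      simp only [mul_add, mul_assoc, add_assoc]
  refine ⟨fun w => lift T w 0, fun g h => ?_, fun x => by simp [T]⟩
  change lift T (g * h) 0 = lift T g 0 + el (π g) * lift T h 0
  rw [map_mul, Equiv.Perm.mul_apply, key, add_comm]

end IsDer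

/-- The right ideal spanned by the mod 2 Fox derivatives of `r` is the augmentation ideal. -/
def IsSurfaceRel (π : H →* G) (r : H) : Prop :=
  ∀ a : GA G, (∃ δ, IsDer π δ ∧ δ r = a) ↔ aug G a = 0

theorem eq_zero_of_mul_el {g : G} (hg : orderOf g = 0) {z : GA G} (hz : z * el g = z) : z = 0 := by
  have hn : ∀ n : ℕ, z * el (g ^ n) = z := by
    intro n
    induction n with
    | zero => simp [el_one]
    | succ n ih => rw [pow_succ, el_mul, ← mul_assoc, ih, hz]
  have hc : ∀ (n : ℕ) (h : G), z.coeff (h * g ^ n) = z.coeff h := by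
    intro n h
    conv_lhs => rw [← hn n]
    simp [el, MonoidAlgebra.of_apply]
  by_contra hne
  obtain ⟨h, hh⟩ : ∃ h, z.coeff h ≠ 0 := by
    by_contra hall
    push Not at hall
    exact hne (MonoidAlgebra.coeff_injective (Finsupp.ext hall))
  have hinj : Function.Injective fun n : ℕ => h * g ^ n := by
    intro a b hab
    exact (injective_pow_iff_not_isOfFinOrder.2 (orderOf_eq_zero_iff.1 hg)) (mul_left_cancel hab)
  refine (Set.infinite_range_of_injective hinj) ((z.coeff.support.finite_toSet).subset ?_)
  rintro _ ⟨n, rfl⟩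
  simp [hc, hh]

theorem IsDer.exists_endo_perturbation (π : FreeGroup X →* G) {t : FreeGroup X}
    (hk : π.ker = Subgroup.normalClosure {t}) (θ : FreeGroup X →* FreeGroup X)
    (hθ : π.comp θ = π) :
    ∃ η, IsDer π η ∧ ∀ δ, IsDer π δ → δ (θ t) = δ t + η t * δ t := by
  have ht : π t = 1 := by
    rw [← MonoidHom.mem_ker, hk]; exact Subgroup.subset_normalClosure rfl
  have : ∀ z, ∃ h : GA G, ∀ δ, IsDer π δ → δ (θ (of z)) = δ (of z) + h * δ t := by
    intro z
    obtain ⟨h, hh⟩ := IsDer.normalClosure (n := (of z)⁻¹ * θ (of z)) ht (by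
      rw [← hk, MonoidHom.mem_ker, map_mul, map_inv, inv_mul_eq_one]
      exact (DFunLike.congr_fun hθ (of z)).symm)
    refine ⟨el (π (of z)) * h, fun δ hδ => ?_⟩
    conv_lhs => rw [← mul_inv_cancel_left (of z) (θ (of z))]
    rw [hδ, hh δ hδ, mul_assoc]
  choose h hh using this
  obtain ⟨η, hη, hηz⟩ := IsDer.exists_of_generators π h
  refine ⟨η, hη, fun δ hδ => ?_⟩
  have hd : IsDer π fun w => δ (θ w) := by
    have := hδ.comp θ; rwa [hθ] at this
  exact IsDer.eq_of_generators hd (hδ.add (hη.mul_right _)) (fun z => by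
    rw [hh z δ hδ, hηz]) t

/-- The comparison elements between two one-relator presentations of the same group. -/
theorem exists_comparison (π₁ : FreeGroup X →* G) (π₂ : FreeGroup Y →* G)
    (hs₁ : Function.Surjective π₁) (hs₂ : Function.Surjective π₂) {r : FreeGroup X}
    {R : FreeGroup Y} (hk₁ : π₁.ker = Subgroup.normalClosure {r})
    (hk₂ : π₂.ker = Subgroup.normalClosure {R}) :
    ∃ c c' : GA G,
      (∀ δ, IsDer π₂ δ → ∃ δ', IsDer π₁ δ' ∧ δ' r = c * δ R) ∧
      (∀ δ, IsDer π₁ δ → ∃ δ', IsDer π₂ δ' ∧ δ' R = c' * δ r) ∧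
      (∃ η, IsDer π₂ η ∧ ∀ δ, IsDer π₂ δ → c' * c * δ R = δ R + η R * δ R) ∧
      (∃ η, IsDer π₁ η ∧ ∀ δ, IsDer π₁ δ → c * c' * δ r = δ r + η r * δ r) := by
  choose f hf using fun x => hs₂ (π₁ (of x))
  choose f' hf' using fun y => hs₁ (π₂ (of y))
  have hα : π₂.comp (lift f) = π₁ := by ext x; simp [hf]
  have hβ : π₁.comp (lift f') = π₂ := by ext y; simp [hf']
  have hr : π₁ r = 1 := by
    rw [← MonoidHom.mem_ker, hk₁]; exact Subgroup.subset_normalClosure rfl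
  have hR : π₂ R = 1 := by
    rw [← MonoidHom.mem_ker, hk₂]; exact Subgroup.subset_normalClosure rfl
  obtain ⟨c, hc⟩ := IsDer.normalClosure (n := lift f r) hR (by
    rw [← hk₂, MonoidHom.mem_ker]; exact (DFunLike.congr_fun hα r).trans hr)
  obtain ⟨c', hc'⟩ := IsDer.normalClosure (n := lift f' R) hr (by
    rw [← hk₁, MonoidHom.mem_ker]; exact (DFunLike.congr_fun hβ R).trans hR)
  have pull₁ : ∀ δ, IsDer π₂ δ → IsDer π₁ fun w => δ (lift f w) := fun δ hδ => by
    have := hδ.comp (lift f); rwa [hα] at this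
  have pull₂ : ∀ δ, IsDer π₁ δ → IsDer π₂ fun w => δ (lift f' w) := fun δ hδ => by
    have := hδ.comp (lift f'); rwa [hβ] at this
  refine ⟨c, c', fun δ hδ => ⟨_, pull₁ δ hδ, hc δ hδ⟩, fun δ hδ => ⟨_, pull₂ δ hδ, hc' δ hδ⟩,
    ?_, ?_⟩
  · obtain ⟨η, hη, h⟩ := IsDer.exists_endo_perturbation π₂ hk₂ ((lift f).comp (lift f')) (by
      rw [← MonoidHom.comp_assoc, hα, hβ])
    refine ⟨η, hη, fun δ hδ => ?_⟩
    rw [← h δ hδ, MonoidHom.comp_apply, hc' _ (pull₁ δ hδ), hc δ hδ, mul_assoc]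
  · obtain ⟨η, hη, h⟩ := IsDer.exists_endo_perturbation π₁ hk₁ ((lift f').comp (lift f)) (by
      rw [← MonoidHom.comp_assoc, hβ, hα])
    refine ⟨η, hη, fun δ hδ => ?_⟩
    rw [← h δ hδ, MonoidHom.comp_apply, hc _ (pull₂ δ hδ), hc' δ hδ, mul_assoc]

end Derivations

section SurfaceRelators

variable {G : Type*} [Group G] {H : Type*} [Group H] {X Y : Type*}

namespace IsDer

variable {π : H →* G} {δ : H → GA G}

/-- The augmentation of a crossed homomorphism is a homomorphism. -/
noncomputable def augHom (hδ : IsDer π δ) : H →* Multiplicative (ZMod 2) where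
  toFun h := Multiplicative.ofAdd (aug G (δ h))
  map_one' := by rw [hδ.one, map_zero]; rfl
  map_mul' g h := by rw [hδ, map_add, map_mul, aug_el, one_mul]; rfl

theorem aug_eq_zero_iff (hδ : IsDer π δ) (h : H) : aug G (δ h) = 0 ↔ hδ.augHom h = 1 := Iff.rfl

theorem list_prod_eq_zero (hδ : IsDer π δ) (l : List H) (h : ∀ w ∈ l, δ w = 0) :
    δ l.prod = 0 := by
  induction l with
  | nil => exact hδ.one
  | cons a l ih =>
    rw [List.prod_cons, hδ, h a (by simp), ih fun w hw => h w (by simp [hw])]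
    simp

theorem list_prod_eq (hδ : IsDer π δ) (l₁ l₂ : List H) (b : H) (h₁ : ∀ w ∈ l₁, δ w = 0)
    (h₂ : ∀ w ∈ l₂, δ w = 0) : δ (l₁ ++ b :: l₂).prod = el (π l₁.prod) * δ b := by
  rw [List.prod_append, List.prod_cons, hδ, hδ.list_prod_eq_zero l₁ h₁, hδ b,
    hδ.list_prod_eq_zero l₂ h₂]
  simp

theorem commutator_left (hδ : IsDer π δ) {x y : H} (hy : δ y = 0) :
    δ ⁅x, y⁆ = δ x - el (π (x * y * x⁻¹)) * δ x := by
  rw [commutatorElement_def, hδ, hδ, hδ, hδ.inv, hδ.inv, hy]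
  simp [el_mul, mul_assoc, sub_eq_add_neg]

theorem commutator_right (hδ : IsDer π δ) {x y : H} (hx : δ x = 0) :
    δ ⁅x, y⁆ = el (π x) * δ y - el (π ⁅x, y⁆) * δ y := by
  rw [commutatorElement_def, hδ, hδ, hδ, hδ.inv, hδ.inv, hx]
  simp [el_mul, mul_assoc, sub_eq_add_neg]

end IsDer

theorem IsDer.zero (π : H →* G) : IsDer π fun _ => 0 := by
  intro g h
  simp

/-- The subgroup of elements `g` with `g - 1` in the right ideal of Fox derivatives of `r`. -/
def derSubgroup (π : H →* G) (r : H) : Subgroup G where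
  carrier := {g | ∃ δ, IsDer π δ ∧ δ r = el g - 1}
  one_mem' := ⟨_, IsDer.zero π, by simp⟩
  mul_mem' := by
    rintro a b ⟨δ, hδ, h⟩ ⟨δ', hδ', h'⟩
    refine ⟨_, (hδ.mul_right (el b)).add hδ', ?_⟩
    simp only [h, h', sub_mul, el_mul, one_mul]
    abel
  inv_mem' := by
    rintro a ⟨δ, hδ, h⟩
    refine ⟨_, hδ.mul_right (-el a⁻¹), ?_⟩
    simp only [h, sub_mul, mul_neg, ← el_mul, mul_inv_cancel, el_one, one_mul]
    abel

theorem mem_derSubgroup_of_sub {π : H →* G} {r : H} {g h : G}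
    (H' : ∀ m, ∃ δ, IsDer π δ ∧ δ r = el g * m - el h * m) : h * g⁻¹ ∈ derSubgroup π r := by
  obtain ⟨δ, hδ, hr⟩ := H' (-el g⁻¹)
  refine ⟨δ, hδ, ?_⟩
  rw [hr]
  simp only [mul_neg, ← el_mul, mul_inv_cancel, el_one]
  abel

theorem isSurfaceRel_of_derSubgroup_eq_top {π : H →* G} {r : H}
    (h : derSubgroup π r = ⊤) (haug : ∀ δ, IsDer π δ → aug G (δ r) = 0) : IsSurfaceRel π r := by
  intro a
  refine ⟨by rintro ⟨δ, hδ, rfl⟩; exact haug δ hδ, fun ha => ?_⟩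
  have key : ∀ a : GA G, ∃ δ, IsDer π δ ∧ δ r = a - algebraMap (ZMod 2) _ (aug G a) := by
    intro a
    induction a using MonoidAlgebra.induction_linear with
    | zero => exact ⟨_, IsDer.zero π, by simp⟩
    | add x y hx hy =>
      obtain ⟨δ, hδ, h⟩ := hx
      obtain ⟨δ', hδ', h'⟩ := hy
      refine ⟨_, hδ.add hδ', ?_⟩
      simp only [h, h', map_add]
      abel
    | single g c =>
      obtain ⟨δ, hδ, hr⟩ : g ∈ derSubgroup π r := h ▸ Subgroup.mem_top g
      refine ⟨_, hδ.mul_right (algebraMap (ZMod 2) _ c), ?_⟩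
      have : (MonoidAlgebra.single g c : GA G) = el g * algebraMap (ZMod 2) _ c := by
        simp [el]
      rw [this, map_mul, aug_el, one_mul, hr, sub_mul, one_mul]
      congr 2
      simp [aug]
  simpa [ha] using key a

theorem isSurfaceRel_orientable (g : ℕ) (π : FreeGroup (Fin g × Bool) →* G)
    (hπ : Function.Surjective π) : IsSurfaceRel π (orientableRelator g) := by
  apply isSurfaceRel_of_derSubgroup_eq_top
  · set K := derSubgroup π (orientableRelator g) with hK
    have gens : ∀ n (hn : n < g), ∀ b, π (of (⟨n, hn⟩, b)) ∈ K := by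
      intro n
      induction n using Nat.strong_induction_on with
      | _ n ih =>
      intro hn
      set f : Fin g → FreeGroup (Fin g × Bool) := fun i => ⁅of (i, false), of (i, true)⁆ with hf
      set L := List.ofFn f with hL
      have hlen : L.length = g := by simp [hL]
      have hsplit : L = L.take n ++ f ⟨n, hn⟩ :: L.drop (n + 1) := by
        conv_lhs => rw [← List.take_append_drop n L, List.drop_eq_getElem_cons (by omega)]
        simp [hL]
      have hne : ∀ (δ : FreeGroup (Fin g × Bool) → GA G) (_ : IsDer π δ)
          (_ : ∀ j : Fin g, j.1 ≠ n → ∀ b, δ (of (j, b)) = 0),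
          δ (orientableRelator g) = el (π (L.take n).prod) * δ (f ⟨n, hn⟩) := by
        intro δ hδ h0
        have hc : ∀ j : Fin g, j.1 ≠ n → δ (f j) = 0 := by
          intro j hj
          rw [hf]
          simp only
          rw [hδ.commutator_left (h0 j hj true), h0 j hj false]
          simp
        change δ L.prod = _
        conv_lhs => rw [hsplit]
        refine hδ.list_prod_eq (L.take n) (L.drop (n + 1)) (f ⟨n, hn⟩) ?_ ?_
        · intro w hw
          obtain ⟨i, hi, rfl⟩ := List.mem_take_iff_getElem.1 hw
          simp only [hL, List.getElem_ofFn]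
          exact hc _ (by simp; omega)
        · intro w hw
          obtain ⟨i, hi, rfl⟩ := List.mem_drop_iff_getElem.1 hw
          simp only [hL, List.getElem_ofFn]
          exact hc _ (by simp; omega)
      have hq : π (L.take n).prod ∈ K := by
        rw [map_list_prod]
        refine Subgroup.list_prod_mem _ ?_
        intro w hw
        obtain ⟨v, hv, rfl⟩ := List.mem_map.1 hw
        obtain ⟨i, hi, rfl⟩ := List.mem_take_iff_getElem.1 hv
        simp only [hL, List.getElem_ofFn, hf, commutatorElement_def, map_mul, map_inv]
        have h1 := ih i (by omega) (by omega) false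
        have h2 := ih i (by omega) (by omega) true
        exact K.mul_mem (K.mul_mem (K.mul_mem h1 h2) (K.inv_mem h1)) (K.inv_mem h2)
      set q := π (L.take n).prod with hqd
      set x := π (of (⟨n, hn⟩, false)) with hx
      set y := π (of (⟨n, hn⟩, true)) with hy
      have e1 : q * (x * y * x⁻¹) * q⁻¹ ∈ K := by
        refine mem_derSubgroup_of_sub fun m => ?_
        obtain ⟨δ, hδ, h⟩ := IsDer.exists_of_generators π
          (fun z : Fin g × Bool => if z = (⟨n, hn⟩, false) then m else 0)
        refine ⟨δ, hδ, ?_⟩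
        rw [hne δ hδ fun j hj b => by
          rw [h, if_neg]; rintro h'; exact hj (congrArg (fun z => z.1.1) h')]
        simp only [hf]
        rw [hδ.commutator_left (by rw [h, if_neg]; simp), h, if_pos rfl]
        simp [el_mul, mul_sub, mul_assoc, hqd, hx, hy]
      have e2 : q * (x * y * x⁻¹ * y⁻¹) * (q * x)⁻¹ ∈ K := by
        refine mem_derSubgroup_of_sub fun m => ?_
        obtain ⟨δ, hδ, h⟩ := IsDer.exists_of_generators π
          (fun z : Fin g × Bool => if z = (⟨n, hn⟩, true) then m else 0)
        refine ⟨δ, hδ, ?_⟩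
        rw [hne δ hδ fun j hj b => by
          rw [h, if_neg]; rintro h'; exact hj (congrArg (fun z => z.1.1) h')]
        simp only [hf]
        rw [hδ.commutator_right (by rw [h, if_neg]; simp), h, if_pos rfl]
        simp [el_mul, mul_sub, mul_assoc, hqd, hx, hy, commutatorElement_def]
      have e3 : x * y * x⁻¹ ∈ K := by
        have := K.mul_mem (K.mul_mem (K.inv_mem hq) e1) hq
        convert this using 1; group
      have e4 : x * y * x⁻¹ * y⁻¹ * x⁻¹ ∈ K := by
        have := K.mul_mem (K.mul_mem (K.inv_mem hq) e2) hq
        convert this using 1; group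
      have e5 : x ∈ K := by
        have := K.inv_mem (K.mul_mem (K.mul_mem (K.inv_mem e4) e3) e3)
        have h5 := K.mul_mem (K.mul_mem (K.inv_mem e3) e4) e3
        convert K.inv_mem h5 using 1; group
      have e6 : y ∈ K := by
        have := K.mul_mem (K.mul_mem (K.inv_mem e5) e3) e5
        convert this using 1; group
      rintro (_ | _)
      exacts [e5, e6]
    rw [eq_top_iff]
    intro a _
    obtain ⟨w, rfl⟩ := hπ a
    have : (lift fun z => π (of z)).range ≤ K := by
      apply FreeGroup.range_lift_le
      rintro _ ⟨z, rfl⟩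
      exact gens z.1.1 z.1.2 z.2
    refine this ⟨w, ?_⟩
    congr 1
    ext z
    simp
  · intro δ hδ
    rw [hδ.aug_eq_zero_iff, orientableRelator, map_list_prod]
    apply List.prod_eq_one
    simp only [List.mem_map, List.mem_ofFn]
    rintro _ ⟨_, ⟨i, rfl⟩, rfl⟩
    rw [map_commutatorElement]
    exact commutatorElement_eq_one_iff_mul_comm.2 (mul_comm _ _)

theorem isSurfaceRel_nonorientable (g : ℕ) (π : FreeGroup (Fin g) →* G)
    (hπ : Function.Surjective π) : IsSurfaceRel π (nonorientableRelator g) := by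
  apply isSurfaceRel_of_derSubgroup_eq_top
  · set K := derSubgroup π (nonorientableRelator g) with hK
    have gens : ∀ n (hn : n < g), π (of ⟨n, hn⟩) ∈ K := by
      intro n
      induction n using Nat.strong_induction_on with
      | _ n ih =>
      intro hn
      set f : Fin g → FreeGroup (Fin g) := fun i => of i ^ 2 with hf
      set L := List.ofFn f with hL
      have hlen : L.length = g := by simp [hL]
      have hsplit : L = L.take n ++ f ⟨n, hn⟩ :: L.drop (n + 1) := by
        conv_lhs => rw [← List.take_append_drop n L, List.drop_eq_getElem_cons (by omega)]
        simp [hL]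
      have hq : π (L.take n).prod ∈ K := by
        rw [map_list_prod]
        refine Subgroup.list_prod_mem _ ?_
        intro w hw
        obtain ⟨v, hv, rfl⟩ := List.mem_map.1 hw
        obtain ⟨i, hi, rfl⟩ := List.mem_take_iff_getElem.1 hv
        simp only [hL, List.getElem_ofFn, hf, map_pow]
        exact K.pow_mem (ih i (by omega) (by omega)) 2
      set q := π (L.take n).prod with hqd
      set x := π (of ⟨n, hn⟩) with hx
      have e1 : q * x * q⁻¹ ∈ K := by
        refine mem_derSubgroup_of_sub fun m => ?_
        obtain ⟨δ, hδ, h⟩ := IsDer.exists_of_generators π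
          (fun z : Fin g => if z = ⟨n, hn⟩ then m else 0)
        have hc : ∀ j : Fin g, j.1 ≠ n → δ (f j) = 0 := by
          intro j hj
          simp only [hf, pow_two]
          rw [hδ, h, if_neg (by rintro rfl; exact hj rfl)]
          simp
        refine ⟨δ, hδ, ?_⟩
        change δ L.prod = _
        have h2 : δ L.prod = el q * δ (f ⟨n, hn⟩) := by
          conv_lhs => rw [hsplit]
          refine hδ.list_prod_eq (L.take n) (L.drop (n + 1)) (f ⟨n, hn⟩) ?_ ?_
          · intro w hw
            obtain ⟨i, hi, rfl⟩ := List.mem_take_iff_getElem.1 hw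
            simp only [hL, List.getElem_ofFn]
            exact hc _ (by simp; omega)
          · intro w hw
            obtain ⟨i, hi, rfl⟩ := List.mem_drop_iff_getElem.1 hw
            simp only [hL, List.getElem_ofFn]
            exact hc _ (by simp; omega)
        have h3 : ∀ a : GA G, -a = a := fun a => neg_eq_of_add_eq_zero_left (add_self_GA a)
        simp only [h2, hf, pow_two]
        rw [hδ, h, if_pos rfl, sub_eq_add_neg, h3, mul_add, el_mul, mul_assoc]
      have e2 : x ∈ K := by
        have := K.mul_mem (K.mul_mem (K.inv_mem hq) e1) hq
        convert this using 1; group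
      exact e2
    rw [eq_top_iff]
    intro a _
    obtain ⟨w, rfl⟩ := hπ a
    have : (lift fun z => π (of z)).range ≤ K := by
      apply FreeGroup.range_lift_le
      rintro _ ⟨z, rfl⟩
      exact gens z.1 z.2
    refine this ⟨w, ?_⟩
    congr 1
    ext z
    simp
  · intro δ hδ
    rw [hδ.aug_eq_zero_iff, nonorientableRelator, map_list_prod]
    apply List.prod_eq_one
    simp only [List.mem_map, List.mem_ofFn]
    rintro _ ⟨_, ⟨i, rfl⟩, rfl⟩
    rw [map_pow, ← ofAdd_toAdd (hδ.augHom (of i)), ← ofAdd_nsmul]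
    generalize Multiplicative.toAdd (hδ.augHom (of i)) = t
    revert t
    decide

end SurfaceRelators

section Transfer

variable {G : Type*} [Group G] {H : Type*} [Group H] {X Y α : Type*}

theorem eq_zero_of_mul_el_sub_one {g : G} (hg : orderOf g = 0) {z : GA G}
    (hz : z * (el g - 1) = 0) : z = 0 := by
  apply eq_zero_of_mul_el hg
  rwa [mul_sub, mul_one, sub_eq_zero] at hz

theorem IsSurfaceRel.transfer {π₁ : FreeGroup X →* G} {π₂ : FreeGroup Y →* G}
    (hs₁ : Function.Surjective π₁) (hs₂ : Function.Surjective π₂) {r : FreeGroup X}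
    {R : FreeGroup Y} (hk₁ : π₁.ker = Subgroup.normalClosure {r})
    (hk₂ : π₂.ker = Subgroup.normalClosure {R}) (hr : IsSurfaceRel π₁ r)
    {g : G} (hg : orderOf g = 0) (hR : R = 1 ∨ ∃ δ, IsDer π₂ δ ∧ δ R = el g - 1) :
    IsSurfaceRel π₂ R := by
  obtain ⟨c, c', h1, h2, ⟨η₂, hη₂, h3⟩, η₁, hη₁, h4⟩ := exists_comparison π₁ π₂ hs₁ hs₂ hk₁ hk₂
  obtain ⟨δ₀, hδ₀, hδr⟩ := (hr (el g - 1)).2 (by simp)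
  have hcc : c * c' = 1 + η₁ r := by
    have := h4 δ₀ hδ₀
    rw [hδr] at this
    rw [← sub_eq_zero]
    apply eq_zero_of_mul_el_sub_one hg
    rw [sub_mul, this, add_mul, one_mul, sub_self]
  have haug : aug G c * aug G c' = 1 := by
    rw [← map_mul, hcc, map_add, (hr _).1 ⟨η₁, hη₁, rfl⟩, map_one, add_zero]
  rcases hR with rfl | ⟨δ₁, hδ₁, hδR⟩
  · obtain ⟨δ', hδ', h⟩ := h2 δ₀ hδ₀
    rw [hδ'.one, hδr] at h
    rw [eq_zero_of_mul_el_sub_one hg h.symm] at haug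
    simp at haug
  · have hcc' : c' * c = 1 + η₂ R := by
      have := h3 δ₁ hδ₁
      rw [hδR] at this
      rw [← sub_eq_zero]
      apply eq_zero_of_mul_el_sub_one hg
      rw [sub_mul, this, add_mul, one_mul, sub_self]
    intro a
    constructor
    · rintro ⟨δ, hδ, rfl⟩
      obtain ⟨δ', hδ', h⟩ := h1 δ hδ
      have := (hr _).1 ⟨δ', hδ', h⟩
      rw [map_mul] at this
      exact (mul_eq_zero.1 this).resolve_left (left_ne_zero_of_mul_eq_one haug)
    · intro ha
      obtain ⟨δ', hδ', h⟩ := (hr (c * a)).2 (by rw [map_mul, ha, mul_zero])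
      obtain ⟨δ'', hδ'', h'⟩ := h2 δ' hδ'
      refine ⟨_, hδ''.sub (hη₂.mul_right a), ?_⟩
      simp only [h', h]
      rw [← mul_assoc, hcc', add_mul, one_mul]
      abel

/-- The map of group algebras induced by a homomorphism. -/
noncomputable def push (f : G →* H) : GA G →+* GA H := MonoidAlgebra.mapDomainRingHom (ZMod 2) f

@[simp] theorem push_el (f : G →* H) (g : G) : push f (el g) = el (f g) := by
  simp [push, el]

@[simp] theorem aug_push (f : G →* H) (a : GA G) : aug H (push f a) = aug G a := by
  induction a using MonoidAlgebra.induction_linear with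
  | zero => simp
  | add x y hx hy => simp [hx, hy]
  | single g c => simp [push, aug]

theorem push_push {K : Type*} [Group K] (f : H →* K) (f' : G →* H) (a : GA G) :
    push f (push f' a) = push (f.comp f') a := by
  induction a using MonoidAlgebra.induction_linear with
  | zero => simp
  | add x y hx hy => simp [hx, hy]
  | single g c => simp [push]

theorem push_id (a : GA G) : push (MonoidHom.id G) a = a := by
  induction a using MonoidAlgebra.induction_linear with
  | zero => simp
  | add x y hx hy => simp [hx, hy]
  | single g c => simp [push]

theorem IsDer.push {K : Type*} [Group K] {π : K →* G} {δ : K → GA G} (hδ : IsDer π δ)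
    (f : G →* H) : IsDer (f.comp π) fun k => push f (δ k) := by
  intro g h
  simp [hδ g h]

/-- The fold homomorphism. -/
def fold (α : Type*) : FreeGroup (α ⊕ α) →* FreeGroup α := lift (Sum.elim of of)

theorem fold_inl (w : FreeGroup α) : fold α (FreeGroup.map Sum.inl w) = w := by
  have : (fold α).comp (FreeGroup.map Sum.inl) = MonoidHom.id _ := by ext; simp [fold]
  exact DFunLike.congr_fun this w

theorem fold_inr (w : FreeGroup α) : fold α (FreeGroup.map Sum.inr w) = w := by
  have : (fold α).comp (FreeGroup.map Sum.inr) = MonoidHom.id _ := by ext; simp [fold]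
  exact DFunLike.congr_fun this w

theorem IsDer.mul_inv_of_eq {π : H →* G} {δ : H → GA G} (hδ : IsDer π δ) {U V : H}
    (h : π U = π V) : δ (U * V⁻¹) = δ U - δ V := by
  rw [hδ, hδ.inv, h, mul_neg, ← mul_assoc, ← el_mul, map_inv, mul_inv_cancel, el_one, one_mul,
    sub_eq_add_neg]

theorem exists_der_inl {D : Type*} [Group D] (π : FreeGroup (α ⊕ α) →* D) {δ : FreeGroup α → GA D}
    (hδ : IsDer (π.comp (FreeGroup.map Sum.inl)) δ) :
    ∃ Δ, IsDer π Δ ∧ (∀ w, Δ (FreeGroup.map Sum.inl w) = δ w) ∧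
      ∀ w, Δ (FreeGroup.map Sum.inr w) = 0 := by
  obtain ⟨Δ, hΔ, h⟩ := IsDer.exists_of_generators π (Sum.elim (fun x => δ (of x)) fun _ => 0)
  refine ⟨Δ, hΔ, fun w => (hΔ.comp (FreeGroup.map Sum.inl)).eq_of_generators hδ ?_ w, fun w =>
    (hΔ.comp (FreeGroup.map Sum.inr)).eq_of_generators (IsDer.zero _) ?_ w⟩
  · intro x
    simp [h]
  · intro x
    simp [h]

theorem isSurfaceRel_of_double {D : Type*} [Group D] {u : FreeGroup α}
    {π : FreeGroup (α ⊕ α) →* D} {ρ : D →* FreeGroup α} (hρ : ∀ w, ρ (π w) = fold α w)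
    (hrel : π (FreeGroup.map Sum.inl u) = π (FreeGroup.map Sum.inr u))
    (h : IsSurfaceRel π (FreeGroup.map Sum.inl u * (FreeGroup.map Sum.inr u)⁻¹)) :
    IsSurfaceRel (MonoidHom.id (FreeGroup α)) u := by
  intro a
  constructor
  · rintro ⟨δ, hδ, rfl⟩
    have hp := hδ.push (π.comp (FreeGroup.map Sum.inl))
    rw [MonoidHom.comp_id] at hp
    obtain ⟨Δ, hΔ, h1, h2⟩ := exists_der_inl π hp
    have := (h _).1 ⟨Δ, hΔ, rfl⟩
    rwa [hΔ.mul_inv_of_eq hrel, h1, h2, sub_zero, aug_push] at this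
  · intro ha
    obtain ⟨δ, hδ, hr⟩ := (h (push (π.comp (FreeGroup.map Sum.inl)) a)).2 (by simpa using ha)
    rw [hδ.mul_inv_of_eq hrel] at hr
    have e1 : (ρ.comp π).comp (FreeGroup.map Sum.inl) = MonoidHom.id (FreeGroup α) := by
      ext x; simp [hρ, fold]
    have e2 : (ρ.comp π).comp (FreeGroup.map Sum.inr) = MonoidHom.id (FreeGroup α) := by
      ext x; simp [hρ, fold]
    have d1 := (hδ.push ρ).comp (FreeGroup.map Sum.inl)
    have d2 := (hδ.push ρ).comp (FreeGroup.map Sum.inr)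
    rw [e1] at d1
    rw [e2] at d2
    refine ⟨_, d1.sub d2, ?_⟩
    rw [← map_sub, hr, push_push, ← MonoidHom.comp_assoc, e1, push_id]

end Transfer

theorem ker_presentedGroup_mk {X : Type*} (r : FreeGroup X) :
    (PresentedGroup.mk {r}).ker = Subgroup.normalClosure {r} :=
  QuotientGroup.ker_mk' _

theorem exists_surfaceRel_of_isSurfaceGroup {G : Type} [Group G] (h : IsSurfaceGroup G) :
    ∃ (X : Type) (π : FreeGroup X →* G) (r : FreeGroup X), Function.Surjective π ∧
      π.ker = Subgroup.normalClosure {r} ∧ IsSurfaceRel π r := by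
  have key : ∀ (X : Type) (r : FreeGroup X) (e : G ≃* PresentedGroup {r}),
      Function.Surjective (e.symm.toMonoidHom.comp (PresentedGroup.mk {r})) ∧
      (e.symm.toMonoidHom.comp (PresentedGroup.mk {r})).ker = Subgroup.normalClosure {r} := by
    intro X r e
    refine ⟨e.symm.surjective.comp (PresentedGroup.mk_surjective _), ?_⟩
    rw [← ker_presentedGroup_mk]
    ext x
    simp [MonoidHom.mem_ker]
  rcases h with ⟨g, -, ⟨e⟩⟩ | ⟨g, -, ⟨e⟩⟩
  · exact ⟨_, _, _, (key _ _ e).1, (key _ _ e).2, isSurfaceRel_orientable g _ (key _ _ e).1⟩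
  · exact ⟨_, _, _, (key _ _ e).1, (key _ _ e).2, isSurfaceRel_nonorientable g _ (key _ _ e).1⟩

theorem orderOf_eq_zero_of_ne_one {α : Type*} {w : FreeGroup α} (hw : w ≠ 1) : orderOf w = 0 := by
  rw [orderOf_eq_zero_iff, isOfFinOrder_iff_pow_eq_one]
  rintro ⟨n, hn, h⟩
  exact hw ((pow_eq_one_iff_left hn.ne').1 h)

theorem isSurfaceRel_of_isSurfaceGroup_double {k : ℕ} (hk : 0 < k) (u : FreeGroup (Fin k))
    (h : IsSurfaceGroup (Double u)) : IsSurfaceRel (MonoidHom.id (FreeGroup (Fin k))) u := by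
  obtain ⟨X, π₁, r, hs₁, hk₁, hr⟩ := exists_surfaceRel_of_isSurfaceGroup h
  let π : FreeGroup (Fin k ⊕ Fin k) →* Double u := PresentedGroup.mk {doubleRel u}
  have hπ : Function.Surjective π := PresentedGroup.mk_surjective _
  have hker : π.ker = Subgroup.normalClosure {doubleRel u} := ker_presentedGroup_mk _
  have hrel : π (FreeGroup.map Sum.inl u) = π (FreeGroup.map Sum.inr u) := by
    have : π (doubleRel u) = 1 := by
      rw [← MonoidHom.mem_ker, hker]; exact Subgroup.subset_normalClosure rfl
    rwa [doubleRel, map_mul, map_inv, mul_inv_eq_one] at this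
  let ρ : Double u →* FreeGroup (Fin k) :=
    PresentedGroup.toGroup (rels := {doubleRel u}) (f := Sum.elim of of) (by
      rintro _ rfl
      change fold _ (doubleRel u) = 1
      rw [doubleRel, map_mul, map_inv, fold_inl, fold_inr, mul_inv_cancel])
  have hρ : ∀ w, ρ (π w) = fold _ w := fun w => rfl
  apply isSurfaceRel_of_double hρ hrel
  have horder : ∀ w : FreeGroup (Fin k), w ≠ 1 → orderOf (π (FreeGroup.map Sum.inl w)) = 0 := by
    intro w hw
    have h1 : ρ (π (FreeGroup.map Sum.inl w)) = w := by rw [hρ, fold_inl]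
    have := orderOf_map_dvd ρ (π (FreeGroup.map Sum.inl w))
    rw [h1, orderOf_eq_zero_of_ne_one hw] at this
    exact Nat.eq_zero_of_zero_dvd this
  by_cases hu : u = 1
  · refine IsSurfaceRel.transfer hs₁ hπ hk₁ hker hr (horder (of ⟨0, hk⟩) ?_) (Or.inl ?_)
    · exact FreeGroup.of_ne_one _
    · simp [hu]
  · refine IsSurfaceRel.transfer hs₁ hπ hk₁ hker hr (horder u hu) (Or.inr ?_)
    obtain ⟨Δ, hΔ, h1, h2⟩ := exists_der_inl π (IsDer.inner (π.comp (FreeGroup.map Sum.inl)) 1)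
    refine ⟨Δ, hΔ, ?_⟩
    rw [hΔ.mul_inv_of_eq hrel, h1, h2]
    simp

section SurfaceWords

variable {G : Type*} [Group G] {α : Type*}

/-- The Fox derivatives of `u` sweep out exactly the mod 2 augmentation ideal. -/
abbrev FoxFull (u : FreeGroup α) : Prop := IsSurfaceRel (MonoidHom.id (FreeGroup α)) u

theorem FoxFull.map {u : FreeGroup α} (hu : FoxFull u) (φ : MulAut (FreeGroup α)) :
    FoxFull (φ u) := by
  intro a
  constructor
  · rintro ⟨δ, hδ, rfl⟩
    have h := (hδ.push φ.symm.toMonoidHom).comp φ.toMonoidHom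
    have e : (φ.symm.toMonoidHom.comp (MonoidHom.id _)).comp φ.toMonoidHom = MonoidHom.id _ := by
      ext x; simp
    rw [e] at h
    simpa using (hu _).1 ⟨_, h, rfl⟩
  · intro ha
    obtain ⟨δ, hδ, hr⟩ := (hu (push φ.symm.toMonoidHom a)).2 (by simpa using ha)
    have h := (hδ.push φ.toMonoidHom).comp φ.symm.toMonoidHom
    have e : (φ.toMonoidHom.comp (MonoidHom.id _)).comp φ.symm.toMonoidHom = MonoidHom.id _ := by
      ext x; simp
    rw [e] at h
    refine ⟨_, h, ?_⟩
    simp [hr, push_push, push_id]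

theorem IsDer.mk_eq_sum {f : FreeGroup α →* G} {δ : FreeGroup α → GA G} (hδ : IsDer f δ)
    {L : List (α × Bool)} (h : ∀ y ∈ L, f (of y.1) = 1) :
    δ (FreeGroup.mk L) = ((L.map Prod.fst).map fun x => δ (of x)).sum := by
  induction L with
  | nil => exact hδ.one
  | cons y L ih =>
    have hy : f (of y.1) = 1 := h y (by simp)
    have h1 : δ (FreeGroup.mk [y]) = δ (of y.1) ∧ f (FreeGroup.mk [y]) = 1 := by
      obtain ⟨x, b⟩ := y
      cases b with
      | true => exact ⟨rfl, hy⟩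
      | false =>
        have : FreeGroup.mk [(x, false)] = (of x)⁻¹ := rfl
        simp only at hy
        rw [this, hδ.inv, map_inv, hy]
        simp only [inv_one, el_one, one_mul, and_true]
        exact neg_eq_of_add_eq_zero_left (add_self_GA _)
    rw [show FreeGroup.mk (y :: L) = FreeGroup.mk [y] * FreeGroup.mk L from rfl, hδ, h1.1, h1.2,
      ih fun z hz => h z (by simp [hz])]
    simp

theorem FoxFull.even_count [DecidableEq α] {L : List (α × Bool)}
    (hu : FoxFull (FreeGroup.mk L)) (x : α) : Even ((L.map Prod.fst).count x) := by
  obtain ⟨δ, hδ, h⟩ := IsDer.exists_of_generators (MonoidHom.id (FreeGroup α))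
    (fun y => if y = x then 1 else 0)
  have h1 := (hu _).1 ⟨δ, hδ, rfl⟩
  have h2 := (hδ.push (1 : FreeGroup α →* Unit)).mk_eq_sum (L := L) (by simp)
  rw [← aug_push (1 : FreeGroup α →* Unit), h2, map_list_sum, List.map_map] at h1
  rw [even_iff_two_dvd, ← CharP.cast_eq_zero_iff (ZMod 2), ← h1]
  induction L.map Prod.fst with
  | nil => simp
  | cons y l ih =>
    rw [List.count_cons, List.map_cons, List.sum_cons, Nat.cast_add, ih, add_comm]
    simp [h, apply_ite]

theorem FoxFull.exists_mem [DecidableEq α] {L : List (α × Bool)}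
    (hu : FoxFull (FreeGroup.mk L)) (x : α) : ∃ y ∈ L, y.1 = x := by
  by_contra! hx
  let f : FreeGroup α →* Multiplicative ℤ :=
    lift fun y => if y = x then Multiplicative.ofAdd 1 else 1
  obtain ⟨δ, hδ, h⟩ := (hu (el (of x) - 1)).2 (by simp)
  have h2 := (hδ.push f).mk_eq_sum (L := L) fun y hy => by simp [f, hx y hy]
  rw [h, Finset.sum_list_map_count, Finset.sum_eq_zero] at h2
  · rw [map_sub, push_el, map_one, sub_eq_zero] at h2
    have h3 := MonoidAlgebra.of_injective (R := ZMod 2) (h2.trans el_one.symm)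
    simp [f] at h3
  · intro y _
    obtain ⟨m, hm⟩ := hu.even_count y
    rw [hm, add_smul, add_self_GA]

end SurfaceWords

section Whitehead

variable {α : Type*}

/-- The inverse of a letter. -/
def bar (y : α × Bool) : α × Bool := (y.1, !y.2)

@[simp] theorem bar_bar (y : α × Bool) : bar (bar y) = y := by simp [bar]

@[simp] theorem bar_fst (y : α × Bool) : (bar y).1 = y.1 := rfl

theorem bar_ne (y : α × Bool) : bar y ≠ y := by
  intro h
  simpa [bar] using congrArg Prod.snd h

theorem eq_or_eq_bar_of_fst {y v : α × Bool} (h : y.1 = v.1) : y = v ∨ y = bar v := by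
  obtain ⟨x, b⟩ := y
  obtain ⟨x', b'⟩ := v
  obtain rfl : x = x' := h
  cases b <;> cases b' <;> simp [bar]

/-- The group element of a letter. -/
def ltr (y : α × Bool) : FreeGroup α := FreeGroup.mk [y]

@[simp] theorem ltr_bar (y : α × Bool) : ltr (bar y) = (ltr y)⁻¹ := rfl

theorem ltr_true (x : α) : ltr (x, true) = of x := rfl

theorem ltr_false (x : α) : ltr (x, false) = (of x)⁻¹ := rfl

/-- The bi-infinite reduced line through the identity on which `u` translates. -/
structure Axis (u : FreeGroup α) where
  /-- The translation length. -/
  period : ℕ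
  period_pos : 0 < period
  /-- The labels of the line. -/
  letter : ℤ → α × Bool
  /-- The vertices of the line. -/
  point : ℤ → FreeGroup α
  letter_add (i : ℤ) : letter (i + period) = letter i
  point_zero : point 0 = 1
  point_succ (i : ℤ) : point (i + 1) = point i * ltr (letter i)
  point_add (i : ℤ) : point (i + period) = u * point i
  letter_succ_ne (i : ℤ) : letter (i + 1) ≠ bar (letter i)

theorem exists_axis [DecidableEq α] {u : FreeGroup α}
    (h : FreeGroup.IsCyclicallyReduced u.toWord) (hu : u ≠ 1) :
    ∃ A : Axis u, (List.range A.period).map (fun i : ℕ => A.letter i) = u.toWord := by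
  set L := u.toWord with hL
  have hn : 0 < L.length := by
    rw [List.length_pos_iff, hL, ne_eq, FreeGroup.toWord_eq_nil_iff]; exact hu
  set n := L.length with hnd
  have hn' : (0 : ℤ) < n := by exact_mod_cast hn
  have hlt : ∀ i : ℤ, (i % n).toNat < n := fun i => by
    have := Int.emod_lt_of_pos i hn'
    have := Int.emod_nonneg i hn'.ne'
    omega
  have hsucc : ∀ i : ℤ, ((i + 1) % n = i % n + 1 ∧ (i + 1) / n = i / n ∧ i % n + 1 < n) ∨
      ((i + 1) % n = 0 ∧ (i + 1) / n = i / n + 1 ∧ i % n + 1 = n) := by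
    intro i
    have h1 := Int.emod_lt_of_pos i hn'
    have h0 := Int.emod_nonneg i hn'.ne'
    have h2 := Int.mul_ediv_add_emod i n
    rcases lt_or_eq_of_le (show i % n + 1 ≤ n by omega) with h3 | h3
    · left
      have := (Int.ediv_emod_unique hn' (a := i + 1) (r := i % n + 1) (q := i / n)).2
        ⟨by omega, by omega, h3⟩
      exact ⟨this.2, this.1, h3⟩
    · right
      have := (Int.ediv_emod_unique hn' (a := i + 1) (r := 0) (q := i / n + 1)).2
        ⟨by rw [mul_add]; omega, by omega, hn'⟩
      exact ⟨this.2, this.1, h3⟩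
  refine ⟨
    { period := n
      period_pos := hn
      letter := fun i => L[(i % n).toNat]'(hlt i)
      point := fun i => u ^ (i / n) * FreeGroup.mk (L.take (i % n).toNat)
      letter_add := fun i => by simp
      point_zero := by simp [← FreeGroup.one_eq_mk]
      point_succ := fun i => ?_
      point_add := fun i => ?_
      letter_succ_ne := fun i => ?_ }, ?_⟩
  · have hmk : FreeGroup.mk (L.take (i % n).toNat) * ltr (L[(i % n).toNat]'(hlt i)) =
        FreeGroup.mk (L.take ((i % n).toNat + 1)) := by
      rw [ltr, FreeGroup.mul_mk, List.take_append_getElem]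
    rw [mul_assoc, hmk]
    have h0 := Int.emod_nonneg i hn'.ne'
    rcases hsucc i with ⟨h1, h2, h3⟩ | ⟨h1, h2, h3⟩
    · rw [h1, h2, show (i % n + 1).toNat = (i % n).toNat + 1 by omega]
    · rw [h1, h2, show (i % n).toNat + 1 = n by omega, hnd, List.take_length, hL,
        FreeGroup.mk_toWord, zpow_add_one]
      simp [← FreeGroup.one_eq_mk]
  · rw [Int.add_emod_right, Int.add_ediv_of_dvd_right (dvd_refl _), Int.ediv_self hn'.ne',
      add_comm, zpow_add, zpow_one, mul_assoc]
  · have h0 := Int.emod_nonneg i hn'.ne'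
    rcases hsucc i with ⟨h1, h2, h3⟩ | ⟨h1, h2, h3⟩
    · have hc := List.isChain_iff_getElem.1 h.isReduced (i % n).toNat (by omega)
      intro he
      simp only [h1, show (i % n + 1).toNat = (i % n).toNat + 1 by omega] at he
      rw [he] at hc
      simp [bar] at hc
    · have hc := h.2 (L[(i % n).toNat]'(hlt i))
        (by rw [List.getLast?_eq_getElem?, ← hnd, show n - 1 = (i % n).toNat by omega]
            exact List.getElem?_eq_getElem _) (L[0]'hn)
        (by rw [List.head?_eq_getElem?]; simp)
      intro he
      simp only [h1, Int.toNat_zero] at he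
      rw [he] at hc
      simp [bar] at hc
  · apply List.ext_getElem
    · simp [hnd]
    · intro i h1 h2
      have : ((i : ℤ) % n).toNat = i := by
        rw [Int.emod_eq_of_lt (by omega) (by omega)]; simp
      simp [this]

/-- The endomorphism `z ↦ x ^ e z * z * x ^ f z` for `z ≠ x`, fixing `x`. -/
def whiteheadHom [DecidableEq α] (x : α) (e f : α → ℤ) : FreeGroup α →* FreeGroup α :=
  lift fun z => if z = x then of x else of x ^ e z * of z * of x ^ f z

theorem whiteheadHom_comp [DecidableEq α] (x : α) (e f : α → ℤ) :
    (whiteheadHom x e f).comp (whiteheadHom x (-e) (-f)) = MonoidHom.id _ := by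
  ext z
  by_cases hz : z = x
  · simp [whiteheadHom, hz]
  · simp only [whiteheadHom, MonoidHom.comp_apply, FreeGroup.lift_apply_of, if_neg hz, map_mul,
      map_zpow, if_true, Pi.neg_apply, MonoidHom.id_apply]
    group

/-- `whiteheadHom` as an automorphism. -/
def whitehead [DecidableEq α] (x : α) (e f : α → ℤ) : MulAut (FreeGroup α) :=
  MonoidHom.toMulEquiv (whiteheadHom x e f) (whiteheadHom x (-e) (-f))
    (by simpa using whiteheadHom_comp x (-e) (-f)) (whiteheadHom_comp x e f)

theorem whitehead_of_self [DecidableEq α] (x : α) (e f : α → ℤ) :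
    whitehead x e f (of x) = of x := by
  simp [whitehead, whiteheadHom]

theorem whitehead_of_ne [DecidableEq α] {x z : α} (h : z ≠ x) (e f : α → ℤ) :
    whitehead x e f (of z) = of x ^ e z * of z * of x ^ f z := by
  simp [whitehead, whiteheadHom, h]

/-- The Whitehead automorphism of a cut `A` with acting letter `v`. -/
theorem exists_whitehead [DecidableEq α] (A : α × Bool → Bool) (v : α × Bool) (hv : A v = true)
    (hv' : A (bar v) = false) :
    ∃ W : MulAut (FreeGroup α), ∀ y, W (ltr y) = (if A y then ltr v else 1) *
      (if y.1 = v.1 then 1 else ltr y) * (if A (bar y) then ltr v else 1)⁻¹ := by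
  obtain ⟨s, hs⟩ : ∃ s : ℤ, ltr v = of v.1 ^ s := by
    obtain ⟨x, b⟩ := v
    cases b
    · exact ⟨-1, by rw [ltr_false, zpow_neg_one]⟩
    · exact ⟨1, by rw [ltr_true, zpow_one]⟩
  refine ⟨whitehead v.1 (fun z => if A (z, true) then s else 0)
    (fun z => -if A (z, false) then s else 0), fun y => ?_⟩
  by_cases hy : y.1 = v.1
  · have hW : whitehead v.1 (fun z => if A (z, true) then s else 0)
        (fun z => -if A (z, false) then s else 0) (ltr v) = ltr v := by
      rw [hs, map_zpow, whitehead_of_self]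
    rcases eq_or_eq_bar_of_fst hy with rfl | rfl
    · simp [hW, hv, hv']
    · simp [hW, hv, hv']
  · obtain ⟨z, b⟩ := y
    simp only at hy
    have hz : ∀ c : Bool, (if c = true then ltr v else 1) = of v.1 ^ (if c = true then s else 0) := by
      intro c; cases c <;> simp [hs]
    cases b
    · simp only [ltr_false, map_inv, whitehead_of_ne hy, hz, hy, bar, if_false, Bool.not_false]
      group
    · simp only [ltr_true, whitehead_of_ne hy, hz, hy, bar, if_false, Bool.not_true]
      group

theorem norm_ltr_le [DecidableEq α] (y : α × Bool) : (ltr y).norm ≤ 1 :=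
  FreeGroup.norm_mk_le

namespace Axis

variable {u : FreeGroup α} (X : Axis u)

theorem letter_period : X.letter X.period = X.letter 0 := by
  simpa using X.letter_add 0

theorem point_period : X.point X.period = u := by
  simpa [X.point_zero] using X.point_add 0

theorem sum_range_letter_succ (f : α × Bool → ℕ) :
    ∑ i ∈ Finset.range X.period, f (X.letter (i + 1)) =
      ∑ i ∈ Finset.range X.period, f (X.letter i) := by
  have h := Finset.sum_range_succ (fun i : ℕ => f (X.letter i)) X.period
  rw [Finset.sum_range_succ', X.letter_period] at h
  push_cast at h
  omega

/-- A Whitehead automorphism shortens `u` by the excess of the acting letter over the cut. -/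
theorem exists_norm_add_le [DecidableEq α] (A : α × Bool → Bool) (v : α × Bool) (hv : A v = true)
    (hv' : A (bar v) = false) :
    ∃ W : MulAut (FreeGroup α),
      (W u).norm + ∑ i ∈ Finset.range X.period, (if (X.letter i).1 = v.1 then 1 else 0) ≤
      X.period + ∑ i ∈ Finset.range X.period,
        (if A (bar (X.letter i)) = A (X.letter (i + 1)) then 0 else 1) := by
  obtain ⟨W, hW⟩ := exists_whitehead A v hv hv'
  set V : α × Bool → FreeGroup α := fun y => if A y then ltr v else 1 with hV
  have hW' : ∀ y, W (ltr y) = V y * (if y.1 = v.1 then 1 else ltr y) * (V (bar y))⁻¹ := hW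
  have key : ∀ m : ℕ, ((V (X.letter 0))⁻¹ * W (X.point m) * V (X.letter m)).norm +
      ∑ i ∈ Finset.range m, (if (X.letter i).1 = v.1 then 1 else 0) ≤ m +
      ∑ i ∈ Finset.range m, (if A (bar (X.letter i)) = A (X.letter (i + 1)) then 0 else 1) := by
    intro m
    induction m with
    | zero => simp [X.point_zero]
    | succ m ih =>
      rw [Finset.sum_range_succ, Finset.sum_range_succ]
      push_cast
      set y := X.letter m
      set z := X.letter (m + 1)
      have h1 : (V (X.letter 0))⁻¹ * W (X.point (m + 1)) * V z =
          (V (X.letter 0))⁻¹ * W (X.point m) * V y * (if y.1 = v.1 then 1 else ltr y) *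
            ((V (bar y))⁻¹ * V z) := by
        rw [X.point_succ, map_mul, hW']
        simp only [mul_assoc]
        rfl
      have h2 : (if y.1 = v.1 then 1 else ltr y).norm + (if y.1 = v.1 then 1 else 0) ≤ 1 := by
        split_ifs
        · simp
        · simpa using norm_ltr_le y
      have h3 : ((V (bar y))⁻¹ * V z).norm ≤ if A (bar y) = A z then 0 else 1 := by
        simp only [hV]
        rcases A (bar y) with _ | _ <;> rcases A z with _ | _ <;>
          simp [norm_ltr_le, FreeGroup.norm_inv_eq]
      rw [h1]
      have h4 := FreeGroup.norm_mul_le ((V (X.letter 0))⁻¹ * W (X.point m) * V y *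
        (if y.1 = v.1 then 1 else ltr y)) ((V (bar y))⁻¹ * V z)
      have h5 := FreeGroup.norm_mul_le ((V (X.letter 0))⁻¹ * W (X.point m) * V y)
        (if y.1 = v.1 then 1 else ltr y)
      omega
  refine ⟨MulAut.conj (V (X.letter 0))⁻¹ * W, ?_⟩
  have := key X.period
  rw [X.point_period, X.letter_period] at this
  simpa [MulAut.mul_apply, MulAut.conj_apply] using this

end Axis

end Whitehead

section WhiteheadGraph

variable {α : Type*} [DecidableEq α] {u : FreeGroup α}

namespace Axis

variable (X : Axis u)

/-- In a shortest word no cut has capacity below the degree of a vertex it separates from its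
inverse. -/
theorem degree_le_cut (hmin : ∀ W : MulAut (FreeGroup α), X.period ≤ (W u).norm)
    (A : α × Bool → Bool) (v : α × Bool) (hv : A v = true) (hv' : A (bar v) = false) :
    ∑ i ∈ Finset.range X.period, (if (X.letter i).1 = v.1 then 1 else 0) ≤
      ∑ i ∈ Finset.range X.period,
        (if A (X.letter i) = A (bar (X.letter (i + 1))) then 0 else 1) := by
  obtain ⟨W, hW⟩ := X.exists_norm_add_le (fun y => A (bar y)) (bar v) (by simpa) (by simpa)
  have := hmin W
  simp only [bar_bar] at hW
  change (W u).norm + ∑ i ∈ Finset.range X.period,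
    (if (X.letter i).1 = v.1 then 1 else 0) ≤ _ at hW
  omega

theorem sum_touching (v : α × Bool) :
    ∑ i ∈ Finset.range X.period, ((if X.letter i = v then 1 else 0) +
      if bar (X.letter (i + 1)) = v then 1 else 0) =
    ∑ i ∈ Finset.range X.period, (if (X.letter i).1 = v.1 then 1 else 0) := by
  rw [Finset.sum_add_distrib, X.sum_range_letter_succ fun y => if bar y = v then 1 else 0,
    ← Finset.sum_add_distrib]
  refine Finset.sum_congr rfl fun i _ => ?_
  generalize X.letter i = y
  by_cases h : y.1 = v.1
  · rcases eq_or_eq_bar_of_fst h with rfl | rfl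
    · simp [bar_ne]
    · simp [bar_ne]
  · rw [if_neg h, if_neg, if_neg]
    · rintro rfl; exact h rfl
    · rintro rfl; exact h rfl

/-- The Whitehead graph of a shortest word involving all generators has no cut vertex. -/
theorem eq_of_forall_edge (hmin : ∀ W : MulAut (FreeGroup α), X.period ≤ (W u).norm)
    (hall : ∀ x, ∃ i < X.period, (X.letter (i : ℕ)).1 = x) {S : Type*} [DecidableEq S]
    (v : α × Bool) (σ : α × Bool → S)
    (hσ : ∀ i : ℤ, X.letter i ≠ v → bar (X.letter (i + 1)) ≠ v →
      σ (X.letter i) = σ (bar (X.letter (i + 1)))) {w : α × Bool} (hw : w ≠ v) :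
    σ w = σ (bar v) := by
  set A : α × Bool → Bool := fun y => decide (y = v ∨ σ y ≠ σ (bar v)) with hA
  set B : α × Bool → Bool := fun y => decide (y ≠ v ∧ σ y ≠ σ (bar v)) with hB
  have hle := X.degree_le_cut hmin A v (by simp [hA]) (by simp [hA, bar_ne])
  have hpt : ∀ i ∈ Finset.range X.period,
      (if A (X.letter i) = A (bar (X.letter (i + 1))) then 0 else 1) ≤
      (if X.letter i = v then 1 else 0) + if bar (X.letter (i + 1)) = v then 1 else 0 := by
    intro i _
    by_cases h1 : X.letter i = v
    · simp only [h1, if_true]; split_ifs <;> omega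
    by_cases h2 : bar (X.letter (i + 1)) = v
    · simp only [h2, if_true]; split_ifs <;> omega
    rw [if_pos]
    · omega
    · simp only [hA, h1, h2, false_or, hσ i h1 h2]
  have heq := (Finset.sum_eq_sum_iff_of_le hpt).1
    (le_antisymm (Finset.sum_le_sum hpt) (by rw [X.sum_touching]; exact hle))
  have hclosed : ∀ i : ℕ, i < X.period → B (X.letter i) = B (bar (X.letter (i + 1))) := by
    intro i hi
    have h := heq i (Finset.mem_range.2 hi)
    by_cases h1 : X.letter i = v
    · have h2 : bar (X.letter (i + 1)) ≠ v := by
        intro h2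
        refine X.letter_succ_ne i ?_
        rw [h1, ← h2, bar_bar]
      simp only [h1, h2, hA, if_true, if_false, hB] at h ⊢
      by_contra h3
      simp [h2] at h h3
      exact h3 h
    · by_cases h2 : bar (X.letter (i + 1)) = v
      · simp only [h1, h2, hA, if_true, if_false, hB] at h ⊢
        by_contra h3
        simp [h1] at h h3
        exact h3 h
      · simp [hB, h1, h2, hσ i h1 h2]
  by_contra hne
  have hBw : B w = true := by simp [hB, hw, hne]
  have hsymm : ∀ y, B y = true → B (bar y) = true := by
    intro w hBw
    by_contra h
    have := X.degree_le_cut hmin B w hBw (by simpa using h)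
    rw [Finset.sum_eq_zero (s := Finset.range X.period)
      (f := fun i => if B (X.letter i) = B (bar (X.letter (i + 1))) then 0 else 1)] at this
    · obtain ⟨i, hi, hx⟩ := hall w.1
      have h0 := Finset.sum_eq_zero_iff.1 (Nat.le_zero.1 this) i (Finset.mem_range.2 hi)
      simp [hx] at h0
    · intro i hi
      rw [if_pos (hclosed i (Finset.mem_range.1 hi))]
  have hstep : ∀ i : ℕ, i < X.period → B (X.letter i) = true → B (X.letter (i + 1)) = true := by
    intro i hi h
    rw [hclosed i hi] at h
    simpa using hsymm _ h
  obtain ⟨i₀, hi₀, hx₀⟩ := hall w.1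
  have h0 : B (X.letter i₀) = true := by
    rcases eq_or_eq_bar_of_fst hx₀ with h | h
    · rw [h, hBw]
    · rw [h, hsymm w hBw]
  have h1 : ∀ m, i₀ ≤ m → m ≤ X.period → B (X.letter m) = true := by
    intro m hm
    induction m, hm using Nat.le_induction with
    | base => exact fun _ => h0
    | succ m _ ih => intro h; push_cast; exact hstep m (by omega) (ih (by omega))
  have h2 : ∀ m : ℕ, m ≤ X.period → B (X.letter m) = true := by
    intro m
    induction m with
    | zero =>
      intro _
      have := h1 X.period hi₀.le le_rfl
      rwa [X.letter_period] at this
    | succ m ih => intro h; push_cast; exact hstep m (by omega) (ih (by omega))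
  obtain ⟨i₁, hi₁, hx₁⟩ := hall v.1
  have h3 := h2 i₁ hi₁.le
  rcases eq_or_eq_bar_of_fst hx₁ with h | h <;> simp [h, hB] at h3

end Axis

end WhiteheadGraph

section AxisGeometry

variable {α : Type*} {u : FreeGroup α}

theorem isReduced_cons_cons_iff {a b : α × Bool} {l : List (α × Bool)} :
    FreeGroup.IsReduced (a :: b :: l) ↔ a ≠ bar b ∧ FreeGroup.IsReduced (b :: l) := by
  rw [FreeGroup.IsReduced, FreeGroup.IsReduced, List.isChain_cons_cons]
  refine and_congr_left fun _ => ?_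
  obtain ⟨x, s⟩ := a
  obtain ⟨y, t⟩ := b
  cases s <;> cases t <;> simp [bar]

theorem toWord_mk_of_isReduced [DecidableEq α] {l : List (α × Bool)} (h : FreeGroup.IsReduced l) :
    (FreeGroup.mk l).toWord = l := by
  rw [FreeGroup.toWord_mk, h.reduce_eq]

theorem toWord_ltr_mul [DecidableEq α] {y : α × Bool} {w : FreeGroup α}
    (h : FreeGroup.IsReduced (y :: w.toWord)) : (ltr y * w).toWord = y :: w.toWord := by
  conv_lhs => rw [← FreeGroup.mk_toWord (x := w), ltr, FreeGroup.mul_mk]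
  exact toWord_mk_of_isReduced h

namespace Axis

variable (X : Axis u)

/-- The axis of the inverse. -/
def reverse : Axis u⁻¹ where
  period := X.period
  period_pos := X.period_pos
  letter i := bar (X.letter (-1 - i))
  point i := X.point (-i)
  letter_add i := by
    rw [← X.letter_add, show -1 - (i + (X.period : ℤ)) + X.period = -1 - i by ring]
  point_zero := by simp [X.point_zero]
  point_succ i := by
    have := X.point_succ (-1 - i)
    rw [show -1 - i + 1 = -i by ring] at this
    rw [this, ltr_bar, mul_inv_cancel_right, show -(i + 1) = -1 - i by ring]
  point_add i := by
    have := X.point_add (-(i + X.period))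
    rw [show -(i + (X.period : ℤ)) + X.period = -i by ring] at this
    rw [this, inv_mul_cancel_left]
  letter_succ_ne i := by
    have := X.letter_succ_ne (-1 - (i + 1))
    rw [show -1 - (i + 1) + 1 = -1 - i by ring] at this
    rw [bar_bar]
    exact this.symm

@[simp] theorem reverse_letter (i : ℤ) : X.reverse.letter i = bar (X.letter (-1 - i)) := rfl

@[simp] theorem reverse_point (i : ℤ) : X.reverse.point i = X.point (-i) := rfl

theorem letter_add_mul (i m : ℤ) : X.letter (i + m * X.period) = X.letter i := by
  induction m using Int.induction_on with
  | zero => simp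
  | succ m ih => rw [add_mul, one_mul, ← add_assoc, X.letter_add, ih]
  | pred m ih => rw [← ih, ← X.letter_add (i + (-(m : ℤ) - 1) * X.period)]; ring_nf

variable [DecidableEq α]

/-- Following the axis forwards from a group element whose word starts compatibly. -/
theorem toWord_segment {l : List (α × Bool)} (i : ℤ) (hl : FreeGroup.IsReduced (X.letter i :: l)) (d : ℕ) :
    ∃ t : List (α × Bool), t.length = d ∧ (t ++ X.letter i :: l).head? = some (X.letter (i - d)) ∧
      ((X.point (i - d))⁻¹ * X.point (i + 1) * FreeGroup.mk l).toWord = t ++ X.letter i :: l := by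
  induction d with
  | zero =>
    refine ⟨[], rfl, by simp, ?_⟩
    rw [Nat.cast_zero, sub_zero, X.point_succ, inv_mul_cancel_left, ltr, FreeGroup.mul_mk]
    exact toWord_mk_of_isReduced hl
  | succ d ih =>
    obtain ⟨t, ht, hhead, hw⟩ := ih
    refine ⟨X.letter (i - d - 1) :: t, by simp [ht], by simp [sub_sub], ?_⟩
    have hp := X.point_succ (i - d - 1)
    rw [sub_add_cancel] at hp
    have hne := X.letter_succ_ne (i - d - 1)
    rw [sub_add_cancel] at hne
    rw [Nat.cast_succ, ← sub_sub, eq_mul_inv_of_mul_eq hp.symm, mul_inv_rev, inv_inv, mul_assoc,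
      mul_assoc, ← mul_assoc _ (X.point (i + 1)), toWord_ltr_mul, hw, List.cons_append]
    rw [hw]
    cases h : t ++ X.letter i :: l with
    | nil => simp at h
    | cons b m =>
      rw [h] at hhead
      obtain rfl : b = X.letter (i - d) := by simpa using hhead
      refine isReduced_cons_cons_iff.2 ⟨?_, ?_⟩
      · intro h'; apply hne; rw [h', bar_bar]
      · rw [← h, ← hw]; exact FreeGroup.isReduced_toWord

theorem suffix_toWord_point {l : List (α × Bool)} (i : ℕ) (hl : FreeGroup.IsReduced (X.letter i :: l)) :
    X.letter i :: l <:+ (X.point (i + 1) * FreeGroup.mk l).toWord ∧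
      i < (X.point (i + 1) * FreeGroup.mk l).norm := by
  obtain ⟨t, ht, -, hw⟩ := X.toWord_segment i hl i
  rw [sub_self, X.point_zero, inv_one, one_mul] at hw
  refine ⟨⟨t, hw.symm⟩, ?_⟩
  rw [FreeGroup.norm, hw]
  simp [ht]

theorem head?_inv_point_mul_point {i j : ℤ} (h : i < j) :
    ((X.point i)⁻¹ * X.point j).toWord.head? = some (X.letter i) := by
  obtain ⟨t, -, hhead, hw⟩ := X.toWord_segment (l := []) (j - 1) (FreeGroup.IsReduced.singleton)
    (j - 1 - i).toNat
  rw [show j - 1 - ((j - 1 - i).toNat : ℤ) = i by omega] at hhead hw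
  rw [sub_add_cancel, ← FreeGroup.one_eq_mk, mul_one] at hw
  rw [hw, hhead]

theorem head?_inv_point_mul_point_of_gt {i j : ℤ} (h : j < i) :
    ((X.point i)⁻¹ * X.point j).toWord.head? = some (bar (X.letter (i - 1))) := by
  have := X.reverse.head?_inv_point_mul_point (i := -i) (j := -j) (by omega)
  simpa [show -1 + i = i - 1 by ring] using this

theorem point_injective : Function.Injective X.point := by
  intro i j h
  by_contra hne
  rcases lt_or_gt_of_ne hne with hlt | hlt
  · have := X.head?_inv_point_mul_point hlt
    simp [h] at this
  · have := X.head?_inv_point_mul_point hlt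
    simp [h] at this

end Axis

end AxisGeometry

section Ends

variable {α : Type*} [DecidableEq α] {u : FreeGroup α}

/-- `s` takes the value `c` almost everywhere on the reduced words with suffix `l`. -/
def AlmostConst (s : FreeGroup α → ZMod 2) (l : List (α × Bool)) (c : ZMod 2) : Prop :=
  {h : FreeGroup α | l <:+ h.toWord ∧ s h ≠ c}.Finite

theorem exists_norm_lt_of_finite {S : Set (FreeGroup α)} (hS : S.Finite) :
    ∃ N, ∀ h ∈ S, h.norm < N := by
  obtain ⟨N, hN⟩ := (hS.image FreeGroup.norm).bddAbove
  exact ⟨N + 1, fun h hh => Nat.lt_succ_of_le (hN ⟨h, hh, rfl⟩)⟩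

theorem exists_almostConst_of_long [Finite α] {s : FreeGroup α → ZMod 2}
    (hs : ∀ y, {h | s (ltr y * h) ≠ s h}.Finite) :
    ∃ N, ∀ l : List (α × Bool), N ≤ l.length → FreeGroup.IsReduced l →
      AlmostConst s l (s (FreeGroup.mk l)) := by
  obtain ⟨N, hN⟩ := exists_norm_lt_of_finite (Set.finite_iUnion hs)
  refine ⟨N, fun l hl hred => ?_⟩
  refine Set.finite_empty.subset ?_
  rintro h ⟨⟨t, ht⟩, hne⟩
  refine absurd ?_ hne
  have hr : FreeGroup.IsReduced (t ++ l) := ht ▸ FreeGroup.isReduced_toWord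
  rw [← FreeGroup.mk_toWord (x := h), ← ht]
  clear ht hne
  induction t with
  | nil => rfl
  | cons y t ih =>
    have hr' : FreeGroup.IsReduced (t ++ l) := List.IsChain.tail hr
    rw [← ih hr', List.cons_append, show FreeGroup.mk (y :: (t ++ l)) =
      ltr y * FreeGroup.mk (t ++ l) from rfl]
    by_contra hne
    have := hN _ (Set.mem_iUnion.2 ⟨y, hne⟩)
    rw [FreeGroup.norm, toWord_mk_of_isReduced hr', List.length_append] at this
    omega

theorem eq_add_of_tails {f : ℤ → ZMod 2} {a b c : ZMod 2} (h : ∀ m ≠ 0, f m = f (m - 1))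
    (h0 : f 0 = f (-1) + c) (ha : ∃ N, ∀ m ≥ N, f m = a) (hb : ∃ N, ∀ m ≤ N, f m = b) :
    a = b + c := by
  obtain ⟨N, hN⟩ := ha
  obtain ⟨M, hM⟩ := hb
  have h1 : ∀ m : ℕ, f m = f 0 := by
    intro m
    induction m with
    | zero => rfl
    | succ m ih => rw [h _ (by omega), ← ih]; congr 1; push_cast; ring
  have h2 : ∀ m : ℕ, f (-1 - m) = f (-1) := by
    intro m
    induction m with
    | zero => simp
    | succ m ih => rw [← ih, h (-1 - m) (by omega)]; congr 1; push_cast; ring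
  rw [← hN N.toNat (by omega), h1, h0, ← h2 (-1 - M).toNat, hM _ (by omega)]

namespace Axis

variable (X : Axis u)

theorem exists_forall_ge_eq {s : FreeGroup α → ZMod 2} {l : List (α × Bool)} {j : ℤ} {c : ZMod 2}
    (hl : FreeGroup.IsReduced (X.letter (j - 1) :: l))
    (hc : AlmostConst s (X.letter (j - 1) :: l) c) :
    ∃ N, ∀ m ≥ N, s (X.point (j + m * X.period) * FreeGroup.mk l) = c := by
  obtain ⟨N, hN⟩ := exists_norm_lt_of_finite hc
  refine ⟨N + |j| + 1, fun m hm => ?_⟩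
  have hp : (1 : ℤ) ≤ X.period := by exact_mod_cast X.period_pos
  have hj := neg_abs_le j
  have hi : (N : ℤ) + 1 ≤ j + m * X.period := by nlinarith [abs_nonneg j]
  obtain ⟨i, hi'⟩ : ∃ i : ℕ, (i : ℤ) + 1 = j + m * X.period :=
    ⟨(j + m * X.period - 1).toNat, by omega⟩
  have hlet : X.letter i = X.letter (j - 1) := by
    rw [← X.letter_add_mul (j - 1) m]; congr 1; omega
  have := X.suffix_toWord_point i (l := l) (by rwa [hlet])
  rw [hlet, hi'] at this
  by_contra hne
  have := hN _ ⟨this.1, hne⟩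
  omega

theorem exists_forall_le_eq {s : FreeGroup α → ZMod 2} {l : List (α × Bool)} {j : ℤ} {c : ZMod 2}
    (hl : FreeGroup.IsReduced (bar (X.letter j) :: l))
    (hc : AlmostConst s (bar (X.letter j) :: l) c) :
    ∃ N, ∀ m ≤ N, s (X.point (j + m * X.period) * FreeGroup.mk l) = c := by
  have e : X.reverse.letter (-j - 1) = bar (X.letter j) := by
    rw [reverse_letter]; congr 2; ring
  obtain ⟨N, hN⟩ := X.reverse.exists_forall_ge_eq (s := s) (l := l) (j := -j) (c := c)
    (by rwa [e]) (by rwa [e])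
  refine ⟨-N, fun m hm => ?_⟩
  have := hN (-m) (by omega)
  rw [reverse_point] at this
  rw [← this]
  congr 3
  simp only [reverse]
  ring

/-- Comparing the two ends of a translate of the axis. -/
theorem almostConst_edge {s Z : FreeGroup α → ZMod 2} (hZ : ∀ h, s (u * h) = Z (u * h) + s h)
    {l : List (α × Bool)} {j : ℤ} {a b c : ZMod 2}
    (hl : FreeGroup.IsReduced (X.letter (j - 1) :: l))
    (hl' : FreeGroup.IsReduced (bar (X.letter j) :: l))
    (ha : AlmostConst s (X.letter (j - 1) :: l) a) (hb : AlmostConst s (bar (X.letter j) :: l) b)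
    (hc : ∀ m : ℤ, Z (X.point (j + m * X.period) * FreeGroup.mk l) = if m = 0 then c else 0) :
    a = b + c := by
  have hstep : ∀ m : ℤ, s (X.point (j + m * X.period) * FreeGroup.mk l) =
      (if m = 0 then c else 0) + s (X.point (j + (m - 1) * X.period) * FreeGroup.mk l) := by
    intro m
    have e : X.point (j + m * X.period) = u * X.point (j + (m - 1) * X.period) := by
      rw [← X.point_add]; congr 1; ring
    rw [← hc, e, mul_assoc, hZ]
  refine eq_add_of_tails (f := fun m => s (X.point (j + m * X.period) * FreeGroup.mk l))
    (fun m hm => ?_) ?_ (X.exists_forall_ge_eq hl ha) (X.exists_forall_le_eq hl' hb)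
  · rw [hstep, if_neg hm, zero_add]
  · rw [hstep, if_pos rfl, add_comm]; rfl

theorem point_mul_mk_ne {l : List (α × Bool)} {a : α × Bool} {i j : ℤ}
    (hl : FreeGroup.IsReduced (a :: l)) (h1 : X.letter (j - 1) ≠ bar a)
    (h2 : bar (X.letter j) ≠ bar a) : X.point j * FreeGroup.mk (a :: l) ≠ X.point i := by
  intro h
  have h3 : FreeGroup.mk (a :: l) = (X.point j)⁻¹ * X.point i := by rw [← h, inv_mul_cancel_left]
  have h4 := congrArg (fun w => (FreeGroup.toWord w).head?) h3
  simp only [toWord_mk_of_isReduced hl, List.head?_cons] at h4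
  rcases lt_trichotomy j i with hlt | rfl | hlt
  · rw [X.head?_inv_point_mul_point hlt, Option.some_inj] at h4
    exact h2 (by rw [h4])
  · simp at h4
  · rw [X.head?_inv_point_mul_point_of_gt hlt, Option.some_inj] at h4
    exact h1 (by rw [h4, bar_bar])

theorem exists_almostConst [Finite α] (hmin : ∀ W : MulAut (FreeGroup α), X.period ≤ (W u).norm)
    (hall : ∀ x, ∃ i < X.period, (X.letter (i : ℕ)).1 = x) {s Z : FreeGroup α → ZMod 2}
    (hZ : ∀ h, s (u * h) = Z (u * h) + s h) (hs : ∀ y, {h | s (ltr y * h) ≠ s h}.Finite)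
    (hsupp : ∀ h, Z h ≠ 0 → ∃ i, h = X.point i) (l : List (α × Bool)) (hne : l ≠ [])
    (hred : FreeGroup.IsReduced l) : ∃ c, AlmostConst s l c := by
  obtain ⟨N, hN⟩ := exists_almostConst_of_long hs
  have key : ∀ d, ∀ l : List (α × Bool), l ≠ [] → FreeGroup.IsReduced l → N ≤ l.length + d →
      ∃ c, AlmostConst s l c := by
    intro d
    induction d with
    | zero => exact fun l _ hred hl => ⟨_, hN l hl hred⟩
    | succ d ih =>
      intro l hne hred hl
      obtain ⟨a, l, rfl⟩ := List.exists_cons_of_ne_nil hne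
      have hch : ∀ y, ∃ c, y ≠ bar a → AlmostConst s (y :: a :: l) c := by
        intro y
        by_cases hy : y = bar a
        · exact ⟨0, fun h => absurd hy h⟩
        · obtain ⟨c, hc⟩ := ih (y :: a :: l) (by simp) (isReduced_cons_cons_iff.2 ⟨hy, hred⟩)
            (by simp at hl ⊢; omega)
          exact ⟨c, fun _ => hc⟩
      choose σ hσ using hch
      have hconst : ∀ y, y ≠ bar a → σ y = σ (bar (bar a)) := by
        intro y hy
        refine X.eq_of_forall_edge hmin hall (bar a) σ (fun i h1 h2 => ?_) hy
        have h1' : X.letter (i + 1 - 1) ≠ bar a := by rwa [add_sub_cancel_right]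
        have := X.almostConst_edge (c := 0) hZ (j := i + 1) (l := a :: l)
          (isReduced_cons_cons_iff.2 ⟨h1', hred⟩) (isReduced_cons_cons_iff.2 ⟨h2, hred⟩) (hσ _ h1')
          (hσ _ h2) fun m => ?_
        · rwa [add_zero, add_sub_cancel_right] at this
        · rw [ite_self]
          by_contra h
          obtain ⟨i', hi'⟩ := hsupp _ h
          refine X.point_mul_mk_ne hred ?_ ?_ hi'
          · rwa [show i + 1 + m * X.period - 1 = i + m * X.period by ring, X.letter_add_mul]
          · rwa [X.letter_add_mul]
      refine ⟨σ (bar (bar a)), ?_⟩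
      refine ((Set.finite_singleton (FreeGroup.mk (a :: l))).union
        (Set.finite_iUnion fun y : {y // y ≠ bar a} => hσ y.1 y.2)).subset ?_
      rintro h ⟨⟨t, ht⟩, hne'⟩
      rcases List.eq_nil_or_concat t with rfl | ⟨t, y, rfl⟩
      · left
        rw [Set.mem_singleton_iff, ← FreeGroup.mk_toWord (x := h), ← ht, List.nil_append]
      · right
        have ht' : t ++ y :: a :: l = h.toWord := by rw [← ht]; simp
        have hr : FreeGroup.IsReduced (y :: a :: l) := by
          have : FreeGroup.IsReduced (t ++ y :: a :: l) := ht' ▸ FreeGroup.isReduced_toWord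
          exact this.infix (List.suffix_append _ _).isInfix
        have hy := (isReduced_cons_cons_iff.1 hr).1
        refine Set.mem_iUnion.2 ⟨⟨y, hy⟩, ⟨t, ht'⟩, ?_⟩
        rwa [hconst y hy]
  exact key N l hne hred (by omega)

/-- Every even 0-1 labelling of the edges of the Whitehead graph of a shortest word is a
coboundary. -/
theorem exists_coboundary [Finite α] (hu : FoxFull u)
    (hmin : ∀ W : MulAut (FreeGroup α), X.period ≤ (W u).norm)
    (hall : ∀ x, ∃ i < X.period, (X.letter (i : ℕ)).1 = x) (c : ℕ → ZMod 2)
    (hc : ∑ j ∈ Finset.range X.period, c j = 0) :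
    ∃ σ : α × Bool → ZMod 2, ∀ j : ℕ, j < X.period →
      σ (X.letter (j - 1)) + σ (bar (X.letter j)) = c j := by
  set z : GA (FreeGroup α) :=
    ∑ j ∈ Finset.range X.period, MonoidAlgebra.single (X.point j) (c j) with hz
  have haug : ∀ (g : FreeGroup α) a, aug _ (MonoidAlgebra.single g a) = a := by
    intro g a; simp [aug]
  obtain ⟨δ, hδ, hr⟩ := (hu z).2 (by rw [hz, map_sum]; simpa only [haug] using hc)
  set s : FreeGroup α → ZMod 2 := fun h => (δ h).coeff h with hs
  have hcoc : ∀ g h, s (g * h) = (δ g).coeff (g * h) + s h := by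
    intro g h
    simp only [hs]
    rw [hδ]
    simp [el, MonoidAlgebra.of_apply]
  have hzc : ∀ h, z.coeff h = ∑ j ∈ Finset.range X.period, if X.point j = h then c j else 0 := by
    intro h
    simp [hz, MonoidAlgebra.coeff_sum, Finsupp.single_apply]
  have hZ : ∀ h, s (u * h) = z.coeff (u * h) + s h := by
    intro h
    rw [hcoc, hr]
  have hfin : ∀ y, {h | s (ltr y * h) ≠ s h}.Finite := by
    intro y
    refine (((δ (ltr y)).coeff.support.finite_toSet).preimage
      (f := fun h => ltr y * h) (mul_right_injective _).injOn).subset ?_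
    intro h hh
    simp only [Set.mem_ofPred_eq, hcoc, ne_eq, add_eq_right] at hh
    simpa using hh
  have hsupp : ∀ h, z.coeff h ≠ 0 → ∃ i, h = X.point i := by
    intro h hh
    rw [hzc] at hh
    obtain ⟨j, -, hj⟩ := Finset.exists_ne_zero_of_sum_ne_zero hh
    by_contra! hne
    exact hj (if_neg fun h' => hne j h'.symm)
  choose σ hσ using fun y => X.exists_almostConst hmin hall hZ hfin hsupp [y] (by simp)
    (FreeGroup.IsReduced.singleton)
  refine ⟨σ, fun j hj => ?_⟩
  have := X.almostConst_edge (c := c j) (j := j) (l := []) hZ FreeGroup.IsReduced.singleton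
    FreeGroup.IsReduced.singleton (hσ _) (hσ _) fun m => ?_
  · rw [this, add_comm (σ _) (c j), add_assoc, CharTwo.add_self_eq_zero, add_zero]
  · rw [← FreeGroup.one_eq_mk, mul_one, hzc]
    simp only [X.point_injective.eq_iff]
    by_cases hm : m = 0
    · simp [hm, hj]
    · rw [if_neg hm]
      refine Finset.sum_eq_zero fun i hi => if_neg fun h => ?_
      rw [Finset.mem_range] at hi
      rcases lt_or_gt_of_ne hm with h' | h'
      · have : m * X.period ≤ (-1) * X.period := by gcongr; omega
        omega
      · have : 1 * X.period ≤ m * X.period := by gcongr; omega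
        omega

/-- A shortest word has at most two letters per generator. -/
theorem period_le [Fintype α] [Nonempty α] (hu : FoxFull u)
    (hmin : ∀ W : MulAut (FreeGroup α), X.period ≤ (W u).norm)
    (hall : ∀ x, ∃ i < X.period, (X.letter (i : ℕ)).1 = x) :
    X.period ≤ 2 * Fintype.card α := by
  let T : (α × Bool → ZMod 2) →ₗ[ZMod 2] (Fin X.period → ZMod 2) :=
    { toFun := fun σ j => σ (X.letter (j - 1)) + σ (bar (X.letter j))
      map_add' := fun σ τ => by ext j; simp only [Pi.add_apply]; ring
      map_smul' := fun a σ => by ext j; simp [mul_add] }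
  let S : (Fin X.period → ZMod 2) →ₗ[ZMod 2] ZMod 2 :=
    { toFun := fun c => ∑ j, c j
      map_add' := fun c d => by simp [Finset.sum_add_distrib]
      map_smul' := fun a c => by simp [Finset.mul_sum] }
  have hle : LinearMap.ker S ≤ LinearMap.range T := by
    intro c hc
    have hc' : ∑ j, c j = 0 := hc
    obtain ⟨σ, hσ⟩ := X.exists_coboundary hu hmin hall
      (fun j => if h : j < X.period then c ⟨j, h⟩ else 0) (by
        rw [Finset.sum_range]; simpa using hc')
    refine ⟨σ, ?_⟩
    ext j
    exact (hσ j j.2).trans (dif_pos j.2)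
  have h1 := LinearMap.finrank_range_add_finrank_ker T
  have h2 := LinearMap.finrank_range_add_finrank_ker S
  have h3 := Submodule.finrank_mono hle
  have h4 : 0 < Module.finrank (ZMod 2) (LinearMap.ker T) := by
    rw [Module.finrank_pos_iff_exists_ne_zero]
    refine ⟨⟨fun _ => 1, ?_⟩, ?_⟩
    · rw [LinearMap.mem_ker]
      ext j
      exact CharTwo.add_self_eq_zero 1
    · intro h
      have := congrArg Subtype.val h
      have h' := congrFun this (Classical.arbitrary α, true)
      simp at h'
  have h5 := (LinearMap.range S).finrank_le
  simp at h1 h2 h5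
  omega

end Axis

end Ends

section Quadratic

variable {α : Type*} [DecidableEq α]

theorem exists_minimal_norm (u : FreeGroup α) :
    ∃ φ : MulAut (FreeGroup α), ∀ W : MulAut (FreeGroup α), (φ u).norm ≤ (W u).norm := by
  obtain ⟨_, ⟨φ, rfl⟩, hφ⟩ := WellFounded.has_min (wellFounded_lt (α := ℕ))
    (Set.range fun φ : MulAut (FreeGroup α) => (φ u).norm) ⟨_, 1, rfl⟩
  exact ⟨φ, fun W => not_lt.1 (hφ _ ⟨W, rfl⟩)⟩

theorem isCyclicallyReduced_of_minimal {u : FreeGroup α}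
    (hmin : ∀ W : MulAut (FreeGroup α), u.norm ≤ (W u).norm) :
    FreeGroup.IsCyclicallyReduced u.toWord := by
  set c := FreeGroup.reduceCyclically.conjugator u.toWord with hc
  set r := FreeGroup.reduceCyclically u.toWord with hr
  have h : c ++ r ++ FreeGroup.invRev c = u.toWord :=
    FreeGroup.reduceCyclically.conj_conjugator_reduceCyclically u.toWord
  have hcr : FreeGroup.IsCyclicallyReduced r :=
    FreeGroup.reduceCyclically.isCyclicallyReduced FreeGroup.isReduced_toWord
  have e : MulAut.conj (FreeGroup.mk c)⁻¹ u = FreeGroup.mk r := by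
    rw [← FreeGroup.mk_toWord (x := u), ← h, MulAut.conj_apply, ← FreeGroup.mul_mk,
      ← FreeGroup.mul_mk, ← FreeGroup.inv_mk]
    group
  have h1 := hmin (MulAut.conj (FreeGroup.mk c)⁻¹)
  rw [e, FreeGroup.norm, FreeGroup.norm, toWord_mk_of_isReduced hcr.isReduced, ← h] at h1
  simp only [List.length_append, FreeGroup.invRev_length] at h1
  have h2 : c = [] := List.eq_nil_of_length_eq_zero (by omega)
  rw [← h, h2]
  simpa using hcr

/-- A word with a full set of Fox derivatives becomes quadratic after an automorphism. -/
theorem FoxFull.exists_quadratic [Fintype α] [Nonempty α] {u : FreeGroup α} (hu : FoxFull u) :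
    ∃ (φ : MulAut (FreeGroup α)) (L : List (α × Bool)), φ u = FreeGroup.mk L ∧
      ∀ x, (L.map Prod.fst).count x = 2 := by
  obtain ⟨φ, hφ⟩ := exists_minimal_norm u
  have hv : FoxFull (φ u) := hu.map φ
  set v := φ u with hv'
  have hmin : ∀ W : MulAut (FreeGroup α), v.norm ≤ (W v).norm := fun W => hφ (W * φ)
  have hL : FoxFull (FreeGroup.mk v.toWord) := by rwa [FreeGroup.mk_toWord]
  have hne : v ≠ 1 := by
    intro h
    obtain ⟨y, hy, -⟩ := hL.exists_mem (Classical.arbitrary α)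
    simp [h] at hy
  obtain ⟨X, hX⟩ := exists_axis (isCyclicallyReduced_of_minimal hmin) hne
  have hp : X.period = v.norm := by rw [FreeGroup.norm, ← hX]; simp
  have hle : X.period ≤ 2 * Fintype.card α := by
    refine X.period_le hv (by rwa [hp]) fun x => ?_
    obtain ⟨y, hy, rfl⟩ := hL.exists_mem x
    rw [← hX] at hy
    obtain ⟨i, hi, h⟩ : ∃ i < X.period, X.letter (i : ℕ) = y := by simpa using hy
    exact ⟨i, hi, by rw [h]⟩
  refine ⟨φ, v.toWord, FreeGroup.mk_toWord.symm, ?_⟩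
  set M := v.toWord.map Prod.fst with hM
  have hge : ∀ x ∈ Finset.univ, 2 ≤ M.count x := by
    intro x _
    obtain ⟨y, hy, hyx⟩ := hL.exists_mem x
    have h1 : 0 < M.count x := List.count_pos_iff.2 (List.mem_map.2 ⟨y, hy, hyx⟩)
    have h2 : Even (M.count x) := hL.even_count x
    obtain ⟨m, hm⟩ := h2
    omega
  have hsum : ∑ x, M.count x = M.length := by
    have := Multiset.toFinset_sum_count_eq (M : Multiset α)
    simp only [Multiset.coe_count, Multiset.coe_card] at this
    rw [← this]
    refine (Finset.sum_subset (Finset.subset_univ _) fun x _ hx => ?_).symm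
    rw [List.count_eq_zero]
    simpa using hx
  have hlen : M.length = X.period := by rw [hM, List.length_map, hp]; rfl
  have heq : ∑ x : α, 2 = ∑ x, M.count x := by
    refine le_antisymm (Finset.sum_le_sum hge) ?_
    rw [hsum, hlen]
    simpa [mul_comm] using hle
  intro x
  exact ((Finset.sum_eq_sum_iff_of_le hge).1 heq x (Finset.mem_univ x)).symm

end Quadratic

section Moves

variable {α : Type*}

/-- The subgroup generated by the basis elements outside `S`. -/
def away (S : Set α) : Subgroup (FreeGroup α) := Subgroup.closure (of '' Sᶜ)

theorem of_mem_away {S : Set α} {z : α} (hz : z ∉ S) : of z ∈ away S :=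
  Subgroup.subset_closure ⟨z, hz, rfl⟩

theorem away_mono {S T : Set α} (h : S ⊆ T) : away T ≤ away S :=
  Subgroup.closure_mono (Set.image_mono (Set.compl_subset_compl.2 h))

theorem ltr_mem {H : Subgroup (FreeGroup α)} {y : α × Bool} (h : of y.1 ∈ H) : ltr y ∈ H := by
  obtain ⟨z, b⟩ := y
  cases b
  · exact H.inv_mem h
  · exact h

theorem mk_mem {H : Subgroup (FreeGroup α)} {L : List (α × Bool)} (h : ∀ y ∈ L, of y.1 ∈ H) :
    FreeGroup.mk L ∈ H := by
  induction L with
  | nil => exact H.one_mem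
  | cons y L ih =>
    simp only [List.forall_mem_cons] at h
    exact H.mul_mem (ltr_mem h.1) (ih h.2)

theorem mk_mem_away {S : Set α} {L : List (α × Bool)} (h : ∀ y ∈ L, y.1 ∉ S) :
    FreeGroup.mk L ∈ away S :=
  mk_mem fun y hy => of_mem_away (h y hy)

/-- Some automorphism supported on `S` takes `u` to `v`. -/
def Moves (S : Set α) (u v : FreeGroup α) : Prop :=
  ∃ φ : MulAut (FreeGroup α), (∀ w ∈ away S, φ w = w) ∧ φ u = v

namespace Moves

variable {S T : Set α} {u v w : FreeGroup α}

theorem refl (S : Set α) (u : FreeGroup α) : Moves S u u := ⟨1, fun _ _ => rfl, rfl⟩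

theorem trans (h : Moves S u v) (h' : Moves S v w) : Moves S u w := by
  obtain ⟨φ, hφ, rfl⟩ := h
  obtain ⟨ψ, hψ, rfl⟩ := h'
  exact ⟨ψ * φ, fun w hw => by rw [MulAut.mul_apply, hφ w hw, hψ w hw], rfl⟩

theorem symm (h : Moves S u v) : Moves S v u := by
  obtain ⟨φ, hφ, rfl⟩ := h
  refine ⟨φ⁻¹, fun w hw => ?_, MulAut.inv_apply_self _ φ u⟩
  conv_lhs => rw [← hφ w hw]
  exact MulAut.inv_apply_self _ φ w

theorem mono (hST : S ⊆ T) (h : Moves S u v) : Moves T u v := by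
  obtain ⟨φ, hφ, hv⟩ := h
  exact ⟨φ, fun w hw => hφ w (away_mono hST hw), hv⟩

theorem mul_left (hw : w ∈ away S) (h : Moves S u v) : Moves S (w * u) (w * v) := by
  obtain ⟨φ, hφ, rfl⟩ := h
  exact ⟨φ, hφ, by rw [map_mul, hφ w hw]⟩

theorem mul_right (hw : w ∈ away S) (h : Moves S u v) : Moves S (u * w) (v * w) := by
  obtain ⟨φ, hφ, rfl⟩ := h
  exact ⟨φ, hφ, by rw [map_mul, hφ w hw]⟩

end Moves

theorem map_eq_of_mem_away {S : Set α} {f : FreeGroup α →* FreeGroup α}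
    (h : ∀ z ∉ S, f (of z) = of z) {w : FreeGroup α} (hw : w ∈ away S) : f w = w := by
  have : Set.EqOn f (MonoidHom.id _) (Subgroup.closure (of '' Sᶜ)) :=
    MonoidHom.eqOn_closure (by rintro _ ⟨z, hz, rfl⟩; exact h z hz)
  exact this hw

variable [DecidableEq α]

/-- The automorphism `x ↦ a * x * b`, where `a` and `b` do not involve `x`. -/
theorem exists_substitution (x : α) {a b : FreeGroup α} (ha : a ∈ away {x}) (hb : b ∈ away {x}) :
    ∃ φ : MulAut (FreeGroup α), (∀ w ∈ away {x}, φ w = w) ∧ φ (of x) = a * of x * b := by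
  let f : FreeGroup α → FreeGroup α → (FreeGroup α →* FreeGroup α) := fun a b =>
    lift fun z => if z = x then a * of x * b else of z
  have hx : ∀ a b, f a b (of x) = a * of x * b := fun a b => by simp [f]
  have hz : ∀ a b, ∀ z ≠ x, f a b (of z) = of z := fun a b z h => by simp [f, h]
  have hw : ∀ a b, ∀ w ∈ away {x}, f a b w = w := fun a b w h =>
    map_eq_of_mem_away (fun z h => hz a b z h) h
  have hcomp : ∀ a ∈ away {x}, ∀ b ∈ away {x},
      (f a b).comp (f a⁻¹ b⁻¹) = MonoidHom.id _ := by
    intro a ha b hb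
    ext z
    by_cases h : z = x
    · subst h
      simp only [MonoidHom.comp_apply, hx, map_mul, hw a b _ (inv_mem ha), hw a b _ (inv_mem hb),
        MonoidHom.id_apply]
      group
    · simp [hz _ _ z h]
  exact ⟨MonoidHom.toMulEquiv (f a b) (f a⁻¹ b⁻¹)
    (by simpa using hcomp _ (inv_mem ha) _ (inv_mem hb)) (hcomp _ ha _ hb), hw a b, hx a b⟩

/-- The automorphism inverting `x` if necessary. -/
theorem exists_flip (y : α × Bool) :
    ∃ φ : MulAut (FreeGroup α), (∀ w ∈ away {y.1}, φ w = w) ∧ φ (ltr y) = of y.1 := by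
  obtain ⟨x, b⟩ := y
  cases b
  · let f : FreeGroup α →* FreeGroup α := lift fun z => if z = x then (of x)⁻¹ else of z
    have hf : f.comp f = MonoidHom.id _ := by
      ext z
      by_cases h : z = x <;> simp [f, h]
    refine ⟨MonoidHom.toMulEquiv f f hf hf,
      fun w hw => map_eq_of_mem_away (f := f) (fun z hz => ?_) hw, ?_⟩
    · simp [f, show z ≠ x from hz]
    · simp [f, ltr_false]
  · exact ⟨1, fun _ _ => rfl, rfl⟩

theorem moves_square (y : α × Bool) {A B C : FreeGroup α} (hA : A ∈ away {y.1})
    (hB : B ∈ away {y.1}) (hC : C ∈ away {y.1}) :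
    Moves {y.1} (A * ltr y * B * ltr y * C) (of y.1 ^ 2 * (A * B⁻¹ * C)) := by
  obtain ⟨φ, hφ, hy⟩ := exists_flip y
  obtain ⟨ψ, hψ, hy'⟩ := exists_substitution y.1 (inv_mem hA) (mul_mem hA (inv_mem hB))
  refine Moves.trans (v := A * of y.1 * B * of y.1 * C) ⟨φ, hφ, ?_⟩ ⟨ψ, hψ, ?_⟩
  · simp only [map_mul, hφ A hA, hφ B hB, hφ C hC, hy]
  · simp only [map_mul, hψ A hA, hψ B hB, hψ C hC, hy', pow_two]
    group

theorem moves_commutator (x y : α × Bool) (hxy : x.1 ≠ y.1) {P Q R T : FreeGroup α}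
    (hP : P ∈ away {x.1, y.1}) (hQ : Q ∈ away {x.1, y.1}) (hR : R ∈ away {x.1, y.1})
    (hT : T ∈ away {x.1, y.1}) :
    Moves {x.1, y.1} (ltr x * P * ltr y * Q * (ltr x)⁻¹ * R * (ltr y)⁻¹ * T)
      (⁅of x.1, of y.1⁆ * (R * Q * P * T)) := by
  have hx : ({x.1} : Set α) ⊆ {x.1, y.1} := by simp
  have hy : ({y.1} : Set α) ⊆ {x.1, y.1} := by simp
  have hxa := away_mono hx
  have hya := away_mono hy
  have hofx : of x.1 ∈ away ({y.1} : Set α) := of_mem_away (by simpa using hxy)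
  have hofy : of y.1 ∈ away ({x.1} : Set α) := of_mem_away (by simpa using hxy.symm)
  have hV : R * Q ∈ away {x.1, y.1} := mul_mem hR hQ
  obtain ⟨φ, hφ, hφx⟩ := exists_flip x
  refine Moves.trans (Moves.mono hx ⟨φ, hφ, rfl⟩) ?_
  simp only [map_mul, map_inv, hφ P (hxa hP), hφ Q (hxa hQ), hφ R (hxa hR), hφ T (hxa hT), hφx,
    hφ _ (ltr_mem hofy)]
  obtain ⟨φ, hφ, hφy⟩ := exists_flip y
  refine Moves.trans (Moves.mono hy ⟨φ, hφ, rfl⟩) ?_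
  simp only [map_mul, map_inv, hφ P (hya hP), hφ Q (hya hQ), hφ R (hya hR), hφ T (hya hT), hφy,
    hφ _ hofx]
  obtain ⟨φ, hφ, hφy⟩ := exists_substitution y.1 (inv_mem (hya hP)) (inv_mem (hya hQ))
  refine Moves.trans (v := of x.1 * of y.1 * (of x.1)⁻¹ * (R * Q) * (of y.1)⁻¹ * (P * T))
    (Moves.mono hy ⟨φ, hφ, ?_⟩) ?_
  · simp only [map_mul, map_inv, hφ P (hya hP), hφ Q (hya hQ), hφ R (hya hR), hφ T (hya hT), hφy,
      hφ _ hofx]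
    group
  obtain ⟨φ, hφ, hφx⟩ := exists_substitution x.1 (hxa hV) (one_mem _)
  refine Moves.trans (v := R * Q * (of x.1 * of y.1 * (of x.1)⁻¹ * (of y.1)⁻¹) * (P * T))
    (Moves.mono hx ⟨φ, hφ, ?_⟩) ?_
  · simp only [map_mul, map_inv, hφ P (hxa hP), hφ Q (hxa hQ), hφ R (hxa hR), hφ T (hxa hT), hφx,
      hφ _ hofy]
    group
  obtain ⟨φ, hφ, hφx⟩ := exists_substitution x.1 (inv_mem (hxa hV)) (hxa hV)
  obtain ⟨ψ, hψ, hψy⟩ := exists_substitution y.1 (inv_mem (hya hV)) (hya hV)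
  refine Moves.trans (Moves.mono hx ⟨φ, hφ, rfl⟩) ?_
  simp only [map_mul, map_inv, hφ P (hxa hP), hφ Q (hxa hQ), hφ R (hxa hR), hφ T (hxa hT), hφx,
    hφ _ hofy]
  refine Moves.mono hy ⟨ψ, hψ, ?_⟩
  simp only [map_mul, map_inv, hψ P (hya hP), hψ Q (hya hQ), hψ R (hya hR), hψ T (hya hT), hψy,
    hψ _ hofx, commutatorElement_def]
  group

theorem moves_uncross (x : α × Bool) {U : Set α} (hx : x.1 ∉ U) {B C : FreeGroup α}
    (hB : B ∈ Subgroup.closure (of '' U)) (hC : C ∈ away (insert x.1 U)) :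
    Moves (insert x.1 U) (ltr x * B * (ltr x)⁻¹ * C) (B * C) := by
  classical
  have hsub : ({x.1} : Set α) ⊆ insert x.1 U := by simp
  have hne : ∀ z ∈ U, z ≠ x.1 := fun z hz h => hx (h ▸ hz)
  have hsub' : U ⊆ ({x.1} : Set α)ᶜ := hne
  have hB' : B ∈ away {x.1} := Subgroup.closure_mono (Set.image_mono hsub') hB
  have hC' : C ∈ away {x.1} := away_mono hsub hC
  obtain ⟨φ, hφ, hφx⟩ := exists_flip x
  refine Moves.trans (Moves.mono hsub ⟨φ, hφ, rfl⟩) ?_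
  simp only [map_mul, map_inv, hφ B hB', hφ C hC', hφx]
  let ψ := whitehead x.1 (fun z => if z ∈ U then -1 else 0) (fun z => if z ∈ U then 1 else 0)
  have hψx : ψ (of x.1) = of x.1 := whitehead_of_self _ _ _
  have hψ : ∀ w ∈ away (insert x.1 U), ψ w = w := by
    refine fun w hw => map_eq_of_mem_away (f := ψ.toMonoidHom) (fun z hz => ?_) hw
    rw [Set.mem_insert_iff, not_or] at hz
    exact (whitehead_of_ne hz.1 _ _).trans (by simp [hz.2])
  have hψB : ψ B = (of x.1)⁻¹ * B * of x.1 := by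
    have : Set.EqOn ψ.toMonoidHom (MulAut.conj (of x.1)⁻¹).toMonoidHom
        (Subgroup.closure (of '' U)) := by
      refine MonoidHom.eqOn_closure ?_
      rintro _ ⟨z, hz, rfl⟩
      refine (whitehead_of_ne (hne z hz) _ _).trans ?_
      simp [hz]
    exact (this hB).trans (by simp)
  refine ⟨ψ, hψ, ?_⟩
  simp only [map_mul, map_inv, hψx, hψB, hψ C hC]
  group

/-- `a² [b, c] ∼ b² c² a²`. -/
theorem moves_handle {a b c : α} (hab : a ≠ b) (hac : a ≠ c) (hbc : b ≠ c) :
    Moves {a, b, c} (of a ^ 2 * ⁅of b, of c⁆) (of b ^ 2 * of c ^ 2 * of a ^ 2) := by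
  have ha : ∀ {z}, z ≠ a → of z ∈ away ({a} : Set α) := fun h => of_mem_away (by simpa using h)
  have hb : ∀ {z}, z ≠ b → of z ∈ away ({b} : Set α) := fun h => of_mem_away (by simpa using h)
  have hc : ∀ {z}, z ≠ c → of z ∈ away ({c} : Set α) := fun h => of_mem_away (by simpa using h)
  have hA : ({a} : Set α) ⊆ {a, b, c} := by simp
  have hB : ({b} : Set α) ⊆ {a, b, c} := by simp
  have hC : ({c} : Set α) ⊆ {a, b, c} := by simp
  obtain ⟨φ, hφ, hφa⟩ := exists_substitution a (one_mem _) (inv_mem (ha hab.symm))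
  refine Moves.trans (v := of a * ltr (b, false) * (of a * of c) * ltr (b, false) * (of c)⁻¹)
    (Moves.mono hA ⟨φ, hφ, ?_⟩) ?_
  · simp only [map_mul, map_inv, hφa, hφ _ (ha hab.symm), hφ _ (ha hac.symm), pow_two,
      commutatorElement_def, ltr_false]
    group
  refine Moves.trans (Moves.mono hB (moves_square (b, false) (hb hab)
    (mul_mem (hb hab) (hb hbc.symm)) (inv_mem (hb hbc.symm)))) ?_
  have h := (moves_square (c, false) (hc hac) (inv_mem (hc hac)) (one_mem _)).mul_left
    (pow_mem (hc hbc) 2)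
  convert Moves.mono hC h using 1
  · simp only [ltr_false]; group
  · simp only [mul_one, inv_inv, pow_two, mul_assoc]

end Moves

section NormalForm

variable {α : Type*}

/-- The product `∏ xᵢ²`. -/
def squares (l : List α) : FreeGroup α := (l.map fun x => of x ^ 2).prod

/-- The product `∏ [aᵢ, bᵢ]`. -/
def commutators (p : List (α × α)) : FreeGroup α := (p.map fun q => ⁅of q.1, of q.2⁆).prod

/-- The entries of a list of pairs. -/
def entries (p : List (α × α)) : List α := p.flatMap fun q => [q.1, q.2]

@[simp] theorem entries_cons (q : α × α) (p : List (α × α)) :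
    entries (q :: p) = q.1 :: q.2 :: entries p := by simp [entries]

theorem squares_cons (x : α) (l : List α) : squares (x :: l) = of x ^ 2 * squares l := by
  simp [squares]

theorem commutators_cons (q : α × α) (p : List (α × α)) :
    commutators (q :: p) = ⁅of q.1, of q.2⁆ * commutators p := by simp [commutators]

theorem squares_mem_away {S : Set α} {l : List α} (h : ∀ x ∈ l, x ∉ S) : squares l ∈ away S := by
  refine list_prod_mem fun w hw => ?_
  obtain ⟨x, hx, rfl⟩ := List.mem_map.1 hw
  exact pow_mem (of_mem_away (h x hx)) 2

theorem commutator_mem {G : Type*} [Group G] {H : Subgroup G} {a b : G} (ha : a ∈ H) (hb : b ∈ H) :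
    ⁅a, b⁆ ∈ H :=
  mul_mem (mul_mem (mul_mem ha hb) (inv_mem ha)) (inv_mem hb)

theorem commutators_mem_away {S : Set α} {p : List (α × α)} (h : ∀ x ∈ entries p, x ∉ S) :
    commutators p ∈ away S := by
  refine list_prod_mem fun w hw => ?_
  obtain ⟨q, hq, rfl⟩ := List.mem_map.1 hw
  exact commutator_mem (of_mem_away (h _ (List.mem_flatMap.2 ⟨q, hq, by simp⟩)))
    (of_mem_away (h _ (List.mem_flatMap.2 ⟨q, hq, by simp⟩)))

/-- A product of squares of, or of commutators of, distinct generators in `S`. -/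
def IsNormal (S : Set α) (v : FreeGroup α) : Prop :=
  (∃ l : List α, l.Nodup ∧ (∀ x ∈ l, x ∈ S) ∧ v = squares l) ∨
    ∃ p : List (α × α), (entries p).Nodup ∧ (∀ x ∈ entries p, x ∈ S) ∧ v = commutators p

theorem IsNormal.mono {S T : Set α} {v : FreeGroup α} (h : S ⊆ T) (hv : IsNormal S v) :
    IsNormal T v := by
  rcases hv with ⟨l, h1, h2, h3⟩ | ⟨l, h1, h2, h3⟩
  · exact Or.inl ⟨l, h1, fun x hx => h (h2 x hx), h3⟩
  · exact Or.inr ⟨l, h1, fun x hx => h (h2 x hx), h3⟩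

theorem map_fst_invRev (L : List (α × Bool)) :
    (FreeGroup.invRev L).map Prod.fst = (L.map Prod.fst).reverse := by
  simp [FreeGroup.invRev, Function.comp_def]

variable [DecidableEq α]

theorem exists_squares (p : List (α × α)) (y : α) (h : (y :: entries p).Nodup) :
    ∃ l : List α, l.Perm (y :: entries p) ∧
      Moves {z | z ∈ y :: entries p} (of y ^ 2 * commutators p) (squares l) := by
  induction p with
  | nil => exact ⟨[y], List.Perm.refl _, by simpa [squares, commutators] using Moves.refl _ _⟩
  | cons q p ih =>
    obtain ⟨a, b⟩ := q
    simp only [entries_cons, List.nodup_cons, List.mem_cons, not_or] at h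
    obtain ⟨⟨hya, hyb, hyp⟩, ⟨hab, hap⟩, hbp, hp⟩ := h
    obtain ⟨l, hl, hm⟩ := ih (List.nodup_cons.2 ⟨hyp, hp⟩)
    refine ⟨a :: b :: l, ?_, ?_⟩
    · rw [entries_cons]
      exact ((hl.cons b).cons a).trans
        (((List.Perm.swap y b _).cons a).trans (List.Perm.swap y a _))
    have hcp : commutators p ∈ away {y, a, b} := commutators_mem_away fun x hx hxS => by
      rcases hxS with rfl | rfl | rfl <;> contradiction
    have h1 := ((moves_handle hya hyb hab).mul_right hcp).mono
      (T := {z | z ∈ y :: entries ((a, b) :: p)}) (by rintro z (rfl | rfl | rfl) <;> simp)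
    have hab' : of a ^ 2 * of b ^ 2 ∈ away {z | z ∈ y :: entries p} :=
      mul_mem (pow_mem (of_mem_away (by simp [hap, Ne.symm hya])) 2)
        (pow_mem (of_mem_away (by simp [hbp, Ne.symm hyb])) 2)
    have h2 := (hm.mul_left hab').mono
      (T := {z | z ∈ y :: entries ((a, b) :: p)}) (by intro z; simp; tauto)
    rw [commutators_cons, squares_cons, squares_cons, ← mul_assoc, ← mul_assoc]
    refine h1.trans ?_
    rw [mul_assoc _ (of y ^ 2)]
    exact h2

theorem IsNormal.exists_square_mul {T : Set α} {w : FreeGroup α} (hw : IsNormal T w) {y : α}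
    (hy : y ∉ T) :
    ∃ v, IsNormal (insert y T) v ∧ Moves (insert y T) (of y ^ 2 * w) v := by
  rcases hw with ⟨l, h1, h2, rfl⟩ | ⟨p, h1, h2, rfl⟩
  · refine ⟨_, Or.inl ⟨y :: l, List.nodup_cons.2 ⟨fun h => hy (h2 y h), h1⟩, ?_, rfl⟩, ?_⟩
    · rintro x (_ | ⟨_, hx⟩)
      · exact Or.inl rfl
      · exact Or.inr (h2 x hx)
    · rw [squares_cons]; exact Moves.refl _ _
  · have hnd : (y :: entries p).Nodup := List.nodup_cons.2 ⟨fun h => hy (h2 y h), h1⟩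
    have hsub : ∀ x ∈ y :: entries p, x ∈ insert y T := by
      rintro x (_ | ⟨_, hx⟩)
      · exact Or.inl rfl
      · exact Or.inr (h2 x hx)
    obtain ⟨l, hl, hm⟩ := exists_squares p y hnd
    exact ⟨_, Or.inl ⟨l, hl.nodup_iff.2 hnd, fun x hx => hsub x (hl.mem_iff.1 hx), rfl⟩,
      hm.mono hsub⟩

theorem IsNormal.exists_commutator_mul {T : Set α} {w : FreeGroup α} (hw : IsNormal T w) {x y : α}
    (hxy : x ≠ y) (hx : x ∉ T) (hy : y ∉ T) :
    ∃ v, IsNormal (insert x (insert y T)) v ∧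
      Moves (insert x (insert y T)) (⁅of x, of y⁆ * w) v := by
  have hcomm : ∀ p : List (α × α), (entries p).Nodup → (∀ z ∈ entries p, z ∈ T) →
      IsNormal (insert x (insert y T)) (⁅of x, of y⁆ * commutators p) := by
    intro p h1 h2
    refine Or.inr ⟨(x, y) :: p, ?_, ?_, by rw [commutators_cons]⟩
    · simp only [entries_cons, List.nodup_cons, List.mem_cons, not_or]
      exact ⟨⟨hxy, fun h => hx (h2 x h)⟩, fun h => hy (h2 y h), h1⟩
    · simp only [entries_cons, List.forall_mem_cons]
      exact ⟨by simp, by simp, fun z hz => Or.inr (Or.inr (h2 z hz))⟩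
  rcases hw with ⟨_ | ⟨c, l⟩, h1, h2, rfl⟩ | ⟨p, h1, h2, rfl⟩
  · exact ⟨_, hcomm [] List.nodup_nil (by simp [entries]), Moves.refl _ _⟩
  · rw [List.forall_mem_cons] at h2
    rw [List.nodup_cons] at h1
    obtain ⟨hc, hl⟩ := h2
    have hcx : c ≠ x := fun h => hx (h ▸ hc)
    have hcy : c ≠ y := fun h => hy (h ▸ hc)
    have hxl : x ∉ l := fun h => hx (hl x h)
    have hyl : y ∉ l := fun h => hy (hl y h)
    refine ⟨_, Or.inl ⟨x :: y :: c :: l, ?_, ?_, rfl⟩, ?_⟩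
    · simp [hxy, Ne.symm hcx, Ne.symm hcy, hxl, hyl, h1]
    · simp only [List.forall_mem_cons]
      exact ⟨by simp, by simp, Or.inr (Or.inr hc), fun z hz => Or.inr (Or.inr (hl z hz))⟩
    have hlc : ∀ z ∈ l, z ∉ ({c, x, y} : Set α) := by
      rintro z hz (rfl | rfl | rfl)
      exacts [h1.1 hz, hxl hz, hyl hz]
    have hC : ({c, x, y} : Set α) ⊆ insert x (insert y T) := by
      rintro z (rfl | rfl | rfl)
      exacts [Or.inr (Or.inr hc), Or.inl rfl, Or.inr (Or.inl rfl)]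
    have hs := squares_mem_away hlc
    have h3 := moves_square (c, true) (A := ⁅of x, of y⁆) (B := 1) (C := squares l)
      (commutator_mem (of_mem_away (by simpa using Ne.symm hcx))
        (of_mem_away (by simpa using Ne.symm hcy))) (one_mem _)
      (away_mono (by simp) hs)
    have h4 := (h3.mono (T := {c, x, y}) (by simp)).trans
      (v := of c ^ 2 * (⁅of x, of y⁆ * 1⁻¹ * squares l))
      (w := of x ^ 2 * of y ^ 2 * of c ^ 2 * squares l) (by
        simpa [mul_assoc] using (moves_handle hcx hcy hxy).mul_right hs)
    convert h4.mono hC using 1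
    · simp only [squares_cons, ltr_true, pow_two, mul_one, mul_assoc]
    · simp only [squares_cons, mul_assoc]
  · exact ⟨_, hcomm p h1 h2, Moves.refl _ _⟩

theorem exists_split_of_count_eq_one {L : List (α × Bool)} {x : α}
    (h : (L.map Prod.fst).count x = 1) :
    ∃ A e B, L = A ++ (x, e) :: B ∧ x ∉ A.map Prod.fst ∧ x ∉ B.map Prod.fst := by
  have hx : x ∈ L.map Prod.fst := List.count_pos_iff.1 (by omega)
  obtain ⟨⟨x, e⟩, hy, rfl⟩ := List.mem_map.1 hx
  obtain ⟨A, B, rfl⟩ := List.append_of_mem hy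
  dsimp only at h
  simp only [List.map_append, List.map_cons, List.count_append, List.count_cons_self] at h
  exact ⟨A, e, B, rfl, List.count_eq_zero.1 (by dsimp only; omega),
    List.count_eq_zero.1 (by dsimp only; omega)⟩

/-- Every quadratic word is equivalent to a product of squares or of commutators. -/
theorem exists_isNormal (n : ℕ) (L : List (α × Bool)) (hn : L.length ≤ n)
    (hL : ∀ x, (L.map Prod.fst).count x = 0 ∨ (L.map Prod.fst).count x = 2) :
    ∃ v, IsNormal {x | x ∈ L.map Prod.fst} v ∧
      Moves {x | x ∈ L.map Prod.fst} (FreeGroup.mk L) v := by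
  induction n generalizing L with
  | zero =>
    obtain rfl := List.eq_nil_of_length_eq_zero (Nat.le_zero.1 hn)
    exact ⟨1, Or.inl ⟨[], by simp [squares]⟩, Moves.refl _ _⟩
  | succ n ih =>
    by_cases hsq : ∃ A y B C, L = A ++ y :: (B ++ y :: C)
    · obtain ⟨A, y, B, C, rfl⟩ := hsq
      have hy := hL y.1
      simp only [List.map_append, List.map_cons, List.count_append, List.count_cons_self] at hy
      have hA : y.1 ∉ A.map Prod.fst := List.count_eq_zero.1 (by omega)
      have hB : y.1 ∉ B.map Prod.fst := List.count_eq_zero.1 (by omega)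
      have hC : y.1 ∉ C.map Prod.fst := List.count_eq_zero.1 (by omega)
      obtain ⟨w, hw, hm⟩ := ih (A ++ FreeGroup.invRev B ++ C)
        (by simp [FreeGroup.invRev_length] at hn ⊢; omega) fun x => by
          have hx := hL x
          by_cases hxy : x = y.1
          · left
            subst hxy
            simp [List.count_append, map_fst_invRev, List.count_eq_zero.2 hA,
              List.count_eq_zero.2 hB, List.count_eq_zero.2 hC]
          · simp only [List.map_append, List.map_cons, List.count_append,
              List.count_cons_of_ne (Ne.symm hxy)] at hx
            simp only [List.map_append, List.count_append, map_fst_invRev, List.count_reverse]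
            omega
      have hyW : y.1 ∉ {x | x ∈ (A ++ FreeGroup.invRev B ++ C).map Prod.fst} := by
        simp only [Set.mem_ofPred_eq, List.map_append, map_fst_invRev, List.mem_append,
          List.mem_reverse]
        tauto
      have hset : {x | x ∈ (A ++ y :: (B ++ y :: C)).map Prod.fst} =
          insert y.1 {x | x ∈ (A ++ FreeGroup.invRev B ++ C).map Prod.fst} := by
        ext x
        simp only [Set.mem_ofPred_eq, Set.mem_insert_iff, List.map_append, List.map_cons,
          map_fst_invRev, List.mem_append, List.mem_cons, List.mem_reverse]
        tauto
      obtain ⟨v, hv, hmv⟩ := hw.exists_square_mul hyW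
      refine ⟨v, by rwa [hset], ?_⟩
      rw [hset]
      have hmem : ∀ {D : List (α × Bool)}, y.1 ∉ D.map Prod.fst → FreeGroup.mk D ∈ away {y.1} :=
        fun h => mk_mem_away fun z hz hzy => h (List.mem_map.2 ⟨z, hz, hzy⟩)
      have h1 := (moves_square y (hmem hA) (hmem hB) (hmem hC)).mono
        (T := insert y.1 {x | x ∈ (A ++ FreeGroup.invRev B ++ C).map Prod.fst}) (by simp)
      have h2 := (hm.mul_left (w := of y.1 ^ 2) (pow_mem (of_mem_away hyW) 2)).mono
        (Set.subset_insert y.1 _)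
      convert (h1.trans (by simpa [FreeGroup.inv_mk, FreeGroup.mul_mk] using h2)).trans hmv using 1
      simp [ltr, FreeGroup.mul_mk]
    rcases L with _ | ⟨⟨x, e⟩, M⟩
    · exact ⟨1, Or.inl ⟨[], by simp [squares]⟩, Moves.refl _ _⟩
    have hx := hL x
    simp only [List.map_cons, List.count_cons_self] at hx
    obtain ⟨B, f, C, rfl, hxB, hxC⟩ :=
      exists_split_of_count_eq_one (L := M) (x := x) (by omega)
    have hfe : (x, f) = bar (x, e) := by
      rcases eq_or_eq_bar_of_fst (y := (x, f)) (v := (x, e)) rfl with h | h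
      · exact absurd ⟨[], (x, e), B, C, by rw [h]; rfl⟩ hsq
      · exact h
    rw [hfe] at hL hn hsq ⊢
    by_cases hdisj : ∃ y, y ∈ B.map Prod.fst ∧ y ∈ C.map Prod.fst
    · obtain ⟨y, hyB, hyC⟩ := hdisj
      have hxy : x ≠ y := fun h => hxB (h ▸ hyB)
      have hB1 := List.count_pos_iff.2 hyB
      have hC1 := List.count_pos_iff.2 hyC
      have hy := hL y
      simp only [List.map_append, List.map_cons, List.count_append, bar_fst,
        List.count_cons_of_ne hxy] at hy
      obtain ⟨P, a, Q, rfl, hyP, hyQ⟩ :=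
        exists_split_of_count_eq_one (L := B) (x := y) (by omega)
      obtain ⟨R, b, T, rfl, hyR, hyT⟩ :=
        exists_split_of_count_eq_one (L := C) (x := y) (by omega)
      have hab : (y, b) = bar (y, a) := by
        rcases eq_or_eq_bar_of_fst (y := (y, b)) (v := (y, a)) rfl with h | h
        · exact absurd ⟨(x, e) :: P, (y, a), Q ++ bar (x, e) :: R, T, by rw [h]; simp⟩ hsq
        · exact h
      rw [hab] at hL hn ⊢
      simp only [List.map_append, List.map_cons, List.mem_append, List.mem_cons, not_or]
        at hxB hxC
      obtain ⟨hxP, -, hxQ⟩ := hxB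
      obtain ⟨hxR, -, hxT⟩ := hxC
      obtain ⟨w, hw, hm⟩ := ih (R ++ Q ++ P ++ T) (by simp at hn ⊢; omega) fun z => by
        have hz := hL z
        by_cases hzx : z = x
        · subst hzx
          simp [List.count_append, List.count_eq_zero.2 hxP, List.count_eq_zero.2 hxQ,
            List.count_eq_zero.2 hxR, List.count_eq_zero.2 hxT]
        by_cases hzy : z = y
        · subst hzy
          simp [List.count_append, List.count_eq_zero.2 hyP, List.count_eq_zero.2 hyQ,
            List.count_eq_zero.2 hyR, List.count_eq_zero.2 hyT]
        simp only [List.map_append, List.map_cons, List.count_append, bar_fst,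
          List.count_cons_of_ne (Ne.symm hzx), List.count_cons_of_ne (Ne.symm hzy)] at hz
        simp only [List.map_append, List.count_append]
        omega
      have hxW : x ∉ {z | z ∈ (R ++ Q ++ P ++ T).map Prod.fst} := by
        simp only [Set.mem_ofPred_eq, List.map_append, List.mem_append]
        tauto
      have hyW : y ∉ {z | z ∈ (R ++ Q ++ P ++ T).map Prod.fst} := by
        simp only [Set.mem_ofPred_eq, List.map_append, List.mem_append]
        tauto
      obtain ⟨v, hv, hmv⟩ := hw.exists_commutator_mul hxy hxW hyW
      have hset : {z | z ∈ ((x, e) :: (P ++ (y, a) :: Q ++ bar (x, e) :: (R ++ bar (y, a) ::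
          T))).map Prod.fst} = insert x (insert y {z | z ∈ (R ++ Q ++ P ++ T).map Prod.fst}) := by
        ext z
        simp only [Set.mem_ofPred_eq, Set.mem_insert_iff, List.map_append, List.map_cons, bar_fst,
          List.mem_append, List.mem_cons]
        tauto
      refine ⟨v, by rwa [hset], ?_⟩
      rw [hset]
      have hmem : ∀ {D : List (α × Bool)}, x ∉ D.map Prod.fst → y ∉ D.map Prod.fst →
          FreeGroup.mk D ∈ away {x, y} := fun h h' => mk_mem_away fun z hz hzy => by
        rcases hzy with hzy | hzy
        · exact h (List.mem_map.2 ⟨z, hz, hzy⟩)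
        · exact h' (List.mem_map.2 ⟨z, hz, hzy⟩)
      have h1 := (moves_commutator (x, e) (y, a) hxy (hmem hxP hyP) (hmem hxQ hyQ)
        (hmem hxR hyR) (hmem hxT hyT)).mono
        (T := insert x (insert y {z | z ∈ (R ++ Q ++ P ++ T).map Prod.fst}))
        (by rintro z (rfl | rfl) <;> simp)
      have h2 := (hm.mul_left (w := ⁅of x, of y⁆)
        (commutator_mem (of_mem_away hxW) (of_mem_away hyW))).mono
        ((Set.subset_insert y _).trans (Set.subset_insert x _))
      convert (h1.trans (by simpa [FreeGroup.mul_mk] using h2)).trans hmv using 1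
      simp only [← ltr_bar]
      simp [ltr, FreeGroup.mul_mk]
    · push Not at hdisj
      obtain ⟨w, hw, hm⟩ := ih (B ++ C) (by simp at hn ⊢; omega) fun z => by
        have hz := hL z
        by_cases hzx : z = x
        · subst hzx
          simp [List.count_append, List.count_eq_zero.2 hxB, List.count_eq_zero.2 hxC]
        simp only [List.map_append, List.map_cons, List.count_append, bar_fst,
          List.count_cons_of_ne (Ne.symm hzx)] at hz
        simpa only [List.map_append, List.count_append] using hz
      have hsub : {z | z ∈ (B ++ C).map Prod.fst} ⊆
          {z | z ∈ ((x, e) :: (B ++ bar (x, e) :: C)).map Prod.fst} := by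
        intro z
        simp only [Set.mem_ofPred_eq, List.map_append, List.map_cons, List.mem_append,
          List.mem_cons]
        tauto
      have h1 := moves_uncross (x, e) (U := {z | z ∈ B.map Prod.fst}) hxB
        (B := FreeGroup.mk B) (C := FreeGroup.mk C)
        (mk_mem fun y hy => Subgroup.subset_closure ⟨_, List.mem_map_of_mem hy, rfl⟩)
        (mk_mem_away fun y hy h => by
          have hy' := List.mem_map_of_mem (f := Prod.fst) hy
          rcases h with h | h
          · exact hxC (h.subst (motive := fun z => z ∈ C.map Prod.fst) hy')
          · exact hdisj _ h hy')
      refine ⟨w, hw.mono hsub, Moves.trans ?_ (hm.mono hsub)⟩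
      rw [← ltr_bar] at h1
      have h2 : insert x {z | z ∈ B.map Prod.fst} ⊆
          {z | z ∈ ((x, e) :: (B ++ bar (x, e) :: C)).map Prod.fst} := by
        rintro z (rfl | hz)
        · simp
        · simp only [Set.mem_ofPred_eq, List.map_append, List.map_cons, List.mem_append,
            List.mem_cons]
          exact Or.inr (Or.inl hz)
      convert h1.mono h2 using 1 <;> simp [ltr, FreeGroup.mul_mk]

end NormalForm

section Assembly

theorem squares_eq_mk {α : Type*} (l : List α) :
    squares l = FreeGroup.mk (l.flatMap fun x => [(x, true), (x, true)]) := by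
  induction l with
  | nil => rfl
  | cons x l ih =>
    rw [squares_cons, ih, List.flatMap_cons, ← FreeGroup.mul_mk, pow_two]; rfl

theorem commutators_eq_mk {α : Type*} (p : List (α × α)) :
    commutators p = FreeGroup.mk
      (p.flatMap fun q => [(q.1, true), (q.2, true), (q.1, false), (q.2, false)]) := by
  induction p with
  | nil => rfl
  | cons q p ih =>
    rw [commutators_cons, ih, List.flatMap_cons, ← FreeGroup.mul_mk]; rfl

theorem length_entries {α : Type*} (p : List (α × α)) : (entries p).length = 2 * p.length := by
  induction p with
  | nil => rfl
  | cons q p ih => simp [ih]; ring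

theorem getElem?_entries {α : Type*} (p : List (α × α)) (i : ℕ) :
    (entries p)[2 * i]? = p[i]?.map Prod.fst ∧ (entries p)[2 * i + 1]? = p[i]?.map Prod.snd := by
  induction p generalizing i with
  | nil => simp [entries]
  | cons q p ih =>
    cases i with
    | zero => simp
    | succ i => simpa [mul_add] using ih i

theorem exists_eq_ofFn {k : ℕ} {l : List (Fin k)} (h : l.Nodup) (hl : ∀ x, x ∈ l) :
    ∃ e : Equiv.Perm (Fin k), l = List.ofFn e := by
  have hlen : l.length = k := by
    rw [← List.toFinset_card_of_nodup h, show l.toFinset = Finset.univ by ext x; simp [hl],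
      Finset.card_univ, Fintype.card_fin]
  let f : Fin k → Fin k := fun i => l[(i : ℕ)]
  have hf : l = List.ofFn f := List.ext_getElem (by simp [hlen]) fun i _ _ => by simp [f]
  have hinj : Function.Injective f := List.nodup_ofFn.1 (hf ▸ h)
  exact ⟨Equiv.ofBijective f (Finite.injective_iff_bijective.1 hinj), hf⟩

theorem exists_standard_form {k : ℕ} {v : FreeGroup (Fin k)} (hv : FoxFull v) {S : Set (Fin k)}
    (h : IsNormal S v) :
    ∃ φ : FreeGroup (Fin k) ≃* FreeGroup (Fin k),
      (2 ∣ k ∧ φ v = orientableWordIn k) ∨ φ v = nonorientableWordIn k := by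
  rcases h with ⟨l, hl, -, rfl⟩ | ⟨p, hp, -, rfl⟩
  · obtain ⟨e, rfl⟩ := exists_eq_ofFn hl fun x => by
      rw [squares_eq_mk] at hv
      obtain ⟨y, hy, rfl⟩ := hv.exists_mem x
      obtain ⟨z, hz, hyz⟩ := List.mem_flatMap.1 hy
      have : y = (z, true) := by simpa using hyz
      rwa [this]
    refine ⟨(FreeGroup.freeGroupCongr e).symm, Or.inr ?_⟩
    rw [MulEquiv.symm_apply_eq, nonorientableWordIn, map_list_prod, squares]
    simp [List.map_ofFn, Function.comp_def]
  · have hlen := length_entries p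
    obtain ⟨e, he⟩ := exists_eq_ofFn hp fun x => by
      rw [commutators_eq_mk] at hv
      obtain ⟨y, hy, rfl⟩ := hv.exists_mem x
      obtain ⟨q, hq, hyq⟩ := List.mem_flatMap.1 hy
      refine List.mem_flatMap.2 ⟨q, hq, ?_⟩
      simp only [List.mem_cons, List.not_mem_nil, or_false] at hyq ⊢
      rcases hyq with rfl | rfl | rfl | rfl <;> simp
    rw [he, List.length_ofFn] at hlen
    refine ⟨(FreeGroup.freeGroupCongr e).symm, Or.inl ⟨⟨_, hlen⟩, ?_⟩⟩
    rw [MulEquiv.symm_apply_eq, orientableWordIn, map_list_prod, commutators, List.map_ofFn]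
    congr 1
    refine List.ext_getElem (by simp; omega) fun i h1 h2 => ?_
    have hi : i < p.length := by simpa using h1
    obtain ⟨h3, h4⟩ := getElem?_entries p i
    rw [he, List.getElem?_eq_getElem hi] at h3 h4
    rw [List.getElem?_eq_getElem (by rw [List.length_ofFn]; omega)] at h3 h4
    simp only [List.getElem_ofFn, Option.map_some, Option.some_inj] at h3 h4
    simp [h3, h4, map_commutatorElement]

theorem exists_surfaceWord {k : ℕ} (u : FreeGroup (Fin k)) (h : IsSurfaceGroup (Double u)) :
    ∃ φ : FreeGroup (Fin k) ≃* FreeGroup (Fin k),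
      (2 ∣ k ∧ φ u = orientableWordIn k) ∨ φ u = nonorientableWordIn k := by
  rcases Nat.eq_zero_or_pos k with rfl | hk
  · exact ⟨MulEquiv.refl _, Or.inl ⟨dvd_zero 2, Subsingleton.elim _ _⟩⟩
  have : Nonempty (Fin k) := ⟨⟨0, hk⟩⟩
  have hu : FoxFull u := isSurfaceRel_of_isSurfaceGroup_double hk u h
  obtain ⟨φ, L, hφ, hL⟩ := hu.exists_quadratic
  obtain ⟨v, hv, ψ, -, hψ⟩ := exists_isNormal L.length L le_rfl fun x => Or.inr (hL x)
  have e : v = (ψ * φ) u := by rw [MulAut.mul_apply, hφ, hψ]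
  obtain ⟨χ, hχ⟩ := exists_standard_form (e ▸ hu.map (ψ * φ)) hv
  exact ⟨(ψ * φ).trans χ, by simpa [e] using hχ⟩

end Assembly

end SurfaceWord

/-- If the double `F *_u F` is a surface group, then `u` is a surface word. -/
theorem stmt7 (k : ℕ) (u : FreeGroup (Fin k)) (h : IsSurfaceGroup (Double u)) :
    ∃ φ : FreeGroup (Fin k) ≃* FreeGroup (Fin k),
      (2 ∣ k ∧ φ u = orientableWordIn k) ∨ φ u = nonorientableWordIn k :=
  SurfaceWord.exists_surfaceWord u h
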